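/- arXiv:1103.1521 — 7 statements merged into one kernel-verified Lean document; each statement's English description precedes it below -/
import Mathlib

section
/- Let H be a bipartite graph with parts U and V such that |U| = |V|. Let u* ∈ U and v* ∈ V. If every vertex x of H other than u* and v* has degree at least |V|/2 in H, and both u* and v* have positive degree in H, then H has a perfect matching. -/
open SimpleGraph

/-- Lemma 1 (Cabello–Jakovac): a bipartite graph with parts of equal size in which all
vertices other than `ustar` and `vstar` have degree at least `|V|/2`, and `ustar, vstar`
have positive degree, has a perfect matching. -/
theorem bipartite_halfDegree_perfectMatching
    {W : Type*} [Fintype W] (H : SimpleGraph W) [DecidableRel H.Adj]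
    (U V : Finset W) (hdisj : Disjoint U V) (hcover : ∀ w : W, w ∈ U ∨ w ∈ V)
    (hbip : ∀ a b : W, H.Adj a b → (a ∈ U ∧ b ∈ V) ∨ (a ∈ V ∧ b ∈ U))
    (hcard : U.card = V.card)
    (ustar vstar : W) (hu : ustar ∈ U) (hv : vstar ∈ V)
    (hdeg : ∀ x : W, x ≠ ustar → x ≠ vstar → (V.card : ℝ) / 2 ≤ (H.degree x : ℝ))
    (hdu : 0 < H.degree ustar) (hdv : 0 < H.degree vstar) :
    ∃ M : H.Subgraph, M.IsPerfectMatching := by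
  classical
  have hUV : ∀ a, a ∈ U → a ∉ V := fun a ha hb => Finset.disjoint_left.mp hdisj ha hb
  have hdeg' : ∀ x : W, x ≠ ustar → x ≠ vstar → V.card ≤ 2 * H.degree x := by
    intro x h1 h2
    have h := hdeg x h1 h2
    have h3 : (V.card : ℝ) ≤ 2 * (H.degree x : ℝ) := by linarith
    exact_mod_cast h3
  have hVpos : 0 < V.card := Finset.card_pos.mpr ⟨vstar, hv⟩
  have hpos : ∀ x : W, 0 < H.degree x := by
    intro x
    by_cases h1 : x = ustar
    · rw [h1]; exact hdu
    by_cases h2 : x = vstar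
    · rw [h2]; exact hdv
    have := hdeg' x h1 h2
    omega
  have hall : ∀ S : Finset {x // x ∈ U},
      S.card ≤ (S.biUnion (fun x => H.neighborFinset x.1)).card := by
    intro S
    by_contra hlt
    push Not at hlt
    set N := S.biUnion (fun x => H.neighborFinset x.1) with hN
    have hNV : N ⊆ V := by
      intro b hb
      rw [hN, Finset.mem_biUnion] at hb
      obtain ⟨a, -, hab⟩ := hb
      rw [mem_neighborFinset] at hab
      rcases hbip _ _ hab with h | h
      · exact h.2
      · exact absurd h.1 (hUV _ a.2)
    have hdegN : ∀ a ∈ S, H.degree a.1 ≤ N.card := by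
      intro a ha
      rw [← card_neighborFinset_eq_degree]
      exact Finset.card_le_card (Finset.subset_biUnion_of_mem (fun x : {x // x ∈ U} => H.neighborFinset x.1) ha)
    let S' : Finset W := S.map (Function.Embedding.subtype _)
    have hS'c : S'.card = S.card := Finset.card_map _
    have hS'U : S' ⊆ U := by
      intro a ha
      simp only [S', Finset.mem_map] at ha
      obtain ⟨b, -, rfl⟩ := ha
      exact b.2
    have hSU : S.card ≤ U.card := hS'c ▸ Finset.card_le_card hS'U
    have hSpos : 0 < S.card := by omega
    obtain ⟨a0, ha0⟩ := Finset.card_pos.mp hSpos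
    have h1 := hdegN a0 ha0
    have h1' := hpos a0.1
    have hS2 : 1 < S.card := by omega
    obtain ⟨a, ha, hane⟩ := Finset.exists_mem_ne hS2 ⟨ustar, hu⟩
    have hNhalf : V.card ≤ 2 * N.card := by
      have h2 := hdeg' a.1 (fun h => hane (Subtype.ext h))
        (fun h => hUV _ a.2 (h ▸ hv))
      have h3 := hdegN a ha
      omega
    have hTc : (V \ N).card = V.card - N.card := Finset.card_sdiff_of_subset hNV
    have hTdeg : ∀ b ∈ V \ N, H.degree b ≤ U.card - S.card := by
      intro b hb
      rw [← hS'c, ← Finset.card_sdiff_of_subset hS'U, ← card_neighborFinset_eq_degree]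
      apply Finset.card_le_card
      intro c hc
      rw [mem_neighborFinset] at hc
      rw [Finset.mem_sdiff] at hb ⊢
      refine ⟨?_, ?_⟩
      · rcases hbip _ _ hc with h | h
        · exact absurd hb.1 (hUV _ h.1)
        · exact h.2
      · intro hcS
        simp only [S', Finset.mem_map] at hcS
        obtain ⟨d, hd, rfl⟩ := hcS
        apply hb.2
        rw [hN, Finset.mem_biUnion]
        exact ⟨d, hd, by rw [mem_neighborFinset]; exact hc.symm⟩
    have hTpos : 0 < (V \ N).card := by omega
    obtain ⟨b0, hb0⟩ := Finset.card_pos.mp hTpos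
    have h4 := hTdeg b0 hb0
    have h4' := hpos b0
    have hT2 : 1 < (V \ N).card := by omega
    obtain ⟨b, hb, hbne⟩ := Finset.exists_mem_ne hT2 vstar
    have h5 := hTdeg b hb
    have h6 := hdeg' b (fun h => hUV _ hu (h ▸ (Finset.mem_sdiff.mp hb).1)) hbne
    omega
  obtain ⟨f, hfinj, hf⟩ := (Finset.all_card_le_biUnion_card_iff_exists_injective _).mp hall
  have hadj : ∀ x : {x // x ∈ U}, H.Adj x.1 (f x) := by
    intro x
    have := hf x
    rwa [mem_neighborFinset] at this
  have hfV : ∀ x, f x ∈ V := by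
    intro x
    rcases hbip _ _ (hadj x) with h | h
    · exact h.2
    · exact absurd h.1 (hUV _ x.2)
  have himg : Finset.univ.image f = V := by
    apply Finset.eq_of_subset_of_card_le
    · intro b hb
      obtain ⟨x, -, rfl⟩ := Finset.mem_image.mp hb
      exact hfV x
    · rw [Finset.card_image_of_injective _ hfinj, Finset.card_univ, Fintype.card_coe, hcard]
  let M : H.Subgraph :=
    { verts := Set.univ
      Adj := fun a b => (∃ x : {x // x ∈ U}, x.1 = a ∧ f x = b) ∨
        (∃ x : {x // x ∈ U}, x.1 = b ∧ f x = a)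
      adj_sub := by
        rintro a b (⟨x, rfl, rfl⟩ | ⟨x, rfl, rfl⟩)
        · exact hadj x
        · exact (hadj x).symm
      edge_vert := fun _ => Set.mem_univ _
      symm := ⟨fun a b h => h.symm⟩ }
  refine ⟨M, Subgraph.isPerfectMatching_iff.mpr ?_⟩
  intro w
  rcases hcover w with hw | hw
  · refine ⟨f ⟨w, hw⟩, Or.inl ⟨⟨w, hw⟩, rfl, rfl⟩, ?_⟩
    rintro y (⟨x, rfl, rfl⟩ | ⟨x, rfl, rfl⟩)
    · rfl
    · exact absurd (hfV x) (hUV _ hw)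
  · have hw' := hw
    rw [← himg] at hw'
    obtain ⟨x, -, rfl⟩ := Finset.mem_image.mp hw'
    refine ⟨x.1, Or.inr ⟨x, rfl, rfl⟩, ?_⟩
    rintro y (⟨z, hz, rfl⟩ | ⟨z, rfl, hz⟩)
    · exact absurd hw (hUV _ (hz ▸ z.2))
    · rw [hfinj hz]
end

section
/- If G is a d-regular simple graph that contains no cycle of length 4 (as a subgraph) and G contains a triangle, then the b-chromatic number of G satisfies φ(G) ≥ ⌊(d+4)/2⌋. -/
open SimpleGraph

/-- A b-coloring of `G` with `k` colors: a proper coloring using all `k` colors in which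
every color class contains a vertex adjacent to at least one vertex of each other color class. -/
def IsBColoring {V : Type*} (G : SimpleGraph V) (k : ℕ) (C : V → Fin k) : Prop :=
  (∀ u v : V, G.Adj u v → C u ≠ C v) ∧
  ∀ c : Fin k, ∃ v : V, C v = c ∧ ∀ c' : Fin k, c' ≠ c → ∃ u : V, G.Adj v u ∧ C u = c'

/-- The b-chromatic number: the largest `k` such that `G` admits a b-coloring with `k` colors. -/
noncomputable def bChromaticNumber {V : Type*} (G : SimpleGraph V) : ℕ :=
  sSup {k : ℕ | ∃ C : V → Fin k, IsBColoring G k C}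

/-- `G` contains no cycle of length 4. -/
def NoFourCycle {V : Type*} (G : SimpleGraph V) : Prop :=
  ∀ (v : V) (w : G.Walk v v), w.IsCycle → w.length ≠ 4

namespace BChrom

open Classical in
/-- A Hall-type lemma. -/
lemma hall {V : Type*} (S B : Finset V) (forb : V → V → Prop) (q : ℕ)
    (hc : S.card = B.card) (hq : 2 * q ≤ S.card)
    (h1 : ∀ s ∈ S, (B.filter (fun c => forb s c)).card ≤ q)
    (h2 : ∀ c ∈ B, (S.filter (fun s => forb s c)).card ≤ q) :
    ∃ g : V → V, (∀ s ∈ S, g s ∈ B ∧ ¬ forb s (g s)) ∧ Set.InjOn g S := by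
  let t : S → Finset V := fun s => B.filter (fun c => ¬ forb s c)
  have key : ∀ A : Finset S, A.card ≤ (A.biUnion t).card := by
    intro A
    rcases A.eq_empty_or_nonempty with rfl | ⟨a, ha⟩
    · simp
    by_cases hA : A.card ≤ S.card - q
    · have h3 : (t a).card ≤ (A.biUnion t).card :=
        Finset.card_le_card (Finset.subset_biUnion_of_mem t ha)
      have h4 := Finset.card_filter_add_card_filter_not (s := B) (fun c => forb a c)
      have h5 := h1 a a.2
      have h6 : (t a).card = (B.filter (fun c => ¬ forb a c)).card := rfl
      omega
    · have hB : B ⊆ A.biUnion t := by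
        intro c hcB
        by_contra hcon
        have h3 : A.map ⟨Subtype.val, Subtype.val_injective⟩ ⊆ S.filter (fun s => forb s c) := by
          intro s hs
          simp only [Finset.mem_map, Function.Embedding.coeFn_mk] at hs
          obtain ⟨s', hs', rfl⟩ := hs
          refine Finset.mem_filter.2 ⟨s'.2, ?_⟩
          by_contra hf
          exact hcon (Finset.mem_biUnion.2 ⟨s', hs', Finset.mem_filter.2 ⟨hcB, hf⟩⟩)
        have h4 := Finset.card_le_card h3
        rw [Finset.card_map] at h4
        have := h2 c hcB
        omega
      have h3 : A.card ≤ S.card := by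
        simpa using Finset.card_le_univ A
      have := Finset.card_le_card hB
      omega
  obtain ⟨g, hg, hgt⟩ := (Finset.all_card_le_biUnion_card_iff_exists_injective t).1 key
  refine ⟨fun v => if h : v ∈ S then g ⟨v, h⟩ else v, ?_, ?_⟩
  · intro s hs
    have := hgt ⟨s, hs⟩
    simp only [t, Finset.mem_filter] at this
    simpa [hs] using this
  · intro u hu v hv huv
    have hu' : u ∈ S := hu
    have hv' : v ∈ S := hv
    simp only [hu', hv', dif_pos] at huv
    simpa using hg huv

open Classical in
/-- Greedy extension of a partial proper coloring. -/
lemma greedy {V : Type*} [Fintype V] (G : SimpleGraph V) [DecidableRel G.Adj] (d : ℕ)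
    (hreg : G.IsRegularOfDegree d) (K : Finset V) (hK : d < K.card) (W : Set V) (f : V → V)
    (hfK : ∀ v ∈ W, f v ∈ K) (hf : ∀ u ∈ W, ∀ v ∈ W, G.Adj u v → f u ≠ f v) (U : Finset V) :
    ∃ f' : V → V, (∀ v ∈ W, f' v = f v) ∧ (∀ v, v ∈ W ∨ v ∈ U → f' v ∈ K) ∧
      ∀ u v, (u ∈ W ∨ u ∈ U) → (v ∈ W ∨ v ∈ U) → G.Adj u v → f' u ≠ f' v := by
  induction U using Finset.induction_on with
  | empty => exact ⟨f, fun _ _ => rfl, by simpa using hfK, by simpa using fun u v hu hv => hf u hu v hv⟩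
  | insert a U ha ih =>
    obtain ⟨f', h1, h2, h3⟩ := ih
    by_cases haW : a ∈ W
    · refine ⟨f', h1, ?_, ?_⟩
      · intro v hv
        apply h2
        rcases hv with hv | hv
        · exact Or.inl hv
        · rcases Finset.mem_insert.1 hv with rfl | hv
          · exact Or.inl haW
          · exact Or.inr hv
      · intro u v hu hv
        apply h3
        · rcases hu with hu | hu
          · exact Or.inl hu
          · rcases Finset.mem_insert.1 hu with rfl | hu
            · exact Or.inl haW
            · exact Or.inr hu
        · rcases hv with hv | hv
          · exact Or.inl hv
          · rcases Finset.mem_insert.1 hv with rfl | hv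
            · exact Or.inl haW
            · exact Or.inr hv
    · obtain ⟨c, hcK, hc⟩ : ∃ c ∈ K, c ∉ (G.neighborFinset a).image f' := by
        apply Finset.exists_mem_notMem_of_card_lt_card
        refine lt_of_le_of_lt Finset.card_image_le ?_
        rw [G.card_neighborFinset_eq_degree, hreg a]
        exact hK
      have hc' : ∀ u, G.Adj a u → f' u ≠ c := by
        intro u hu he
        exact hc (Finset.mem_image.2 ⟨u, by simpa using hu, he⟩)
      refine ⟨fun v => if v = a then c else f' v, ?_, ?_, ?_⟩
      · intro v hv
        have : v ≠ a := by rintro rfl; exact haW hv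
        simp [this, h1 v hv]
      · intro v hv
        by_cases hva : v = a
        · simp [hva, hcK]
        · simp only [hva, if_false]
          apply h2
          simpa [hva] using hv
      · intro u v hu hv huv
        by_cases hua : u = a
        · subst hua
          have : v ≠ u := huv.ne'
          simpa [this] using (hc' v huv).symm
        · by_cases hva : v = a
          · subst hva
            simpa [hua] using hc' u huv.symm
          · simp only [hua, hva, if_false]
            apply h3 _ _ _ _ huv
            · simpa [hua] using hu
            · simpa [hva] using hv

open Classical in
/-- Removing color classes without dominating vertices. -/
lemma reduce {V : Type*} [Fintype V] (G : SimpleGraph V) (D : Finset V) (n : ℕ) :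
    ∀ f : V → V, (Finset.univ.image f).card = n → (∀ u v, G.Adj u v → f u ≠ f v) →
      Set.InjOn f D → (∀ v ∈ D, ∀ w, f w ≠ f v → ∃ u, G.Adj v u ∧ f u = f w) →
      ∃ k, D.card ≤ k ∧ ∃ C : V → Fin k, IsBColoring G k C := by
  induction n using Nat.strong_induction_on with
  | _ n ih =>
  intro f hn hf hD hdom
  by_cases hall : ∀ w, ∃ v, f v = f w ∧ ∀ w', f w' ≠ f v → ∃ u, G.Adj v u ∧ f u = f w'
  · let e := (Finset.univ.image f).equivFinOfCardEq hn
    refine ⟨n, ?_, fun v => e ⟨f v, by simp⟩, ?_, ?_⟩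
    · rw [← hn, ← Finset.card_image_of_injOn hD]
      exact Finset.card_le_card (Finset.image_subset_image (Finset.subset_univ _))
    · intro u v huv he
      have := e.injective he
      exact hf u v huv (by simpa using this)
    · intro c
      obtain ⟨⟨c0, hc0⟩, rfl⟩ := e.surjective c
      obtain ⟨w, -, rfl⟩ := Finset.mem_image.1 hc0
      obtain ⟨v, hv, hv'⟩ := hall w
      refine ⟨v, by simp [hv], ?_⟩
      intro c' hc'
      obtain ⟨⟨c1, hc1⟩, rfl⟩ := e.surjective c'
      obtain ⟨w', -, rfl⟩ := Finset.mem_image.1 hc1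
      obtain ⟨u, hu, hu'⟩ := hv' w' (by
        intro h
        apply hc'
        simp [h, hv])
      exact ⟨u, hu, by simp [hu']⟩
  · push Not at hall
    obtain ⟨w, hw⟩ := hall
    choose! g hg hg' using hw
    let f' : V → V := fun v => if f v = f w then f (g v) else f v
    have hne : ∀ v, f' v ≠ f w := by
      intro v
      by_cases h : f v = f w
      · simp only [f', h, if_true]
        rw [← h]; exact hg v h
      · simpa [f', h] using h
    have hsub : ∀ v, ∃ v', f' v = f v' := by
      intro v
      by_cases h : f v = f w
      · exact ⟨g v, by simp [f', h]⟩
      · exact ⟨v, by simp [f', h]⟩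
    have hDw : ∀ v ∈ D, f v ≠ f w := by
      intro v hv h
      obtain ⟨u, hu, hu'⟩ := hdom v hv (g v) (hg v h)
      exact hg' v h u hu hu'
    have hlt : (Finset.univ.image f').card < n := by
      rw [← hn]
      apply Finset.card_lt_card
      rw [Finset.ssubset_iff_of_subset]
      · exact ⟨f w, by simp, by simpa using hne⟩
      · intro c hc
        obtain ⟨v, -, rfl⟩ := Finset.mem_image.1 hc
        obtain ⟨v', hv'⟩ := hsub v
        simp [hv']
    refine ih _ hlt f' rfl ?_ ?_ ?_
    · intro u v huv
      by_cases hu : f u = f w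
      · have hv : f v ≠ f w := by rw [← hu]; exact (hf u v huv).symm
        simp only [f', hu, hv, if_true, if_false]
        exact (hg' u hu v huv).symm
      · by_cases hv : f v = f w
        · simp only [f', hu, hv, if_true, if_false]
          exact hg' v hv u huv.symm
        · simpa [f', hu, hv] using hf u v huv
    · intro u hu v hv huv
      simp only [f', hDw u hu, hDw v hv, if_false] at huv
      exact hD hu hv huv
    · intro v hv z hz
      obtain ⟨z', hz'⟩ := hsub z
      have h1 : f' v = f v := by simp [f', hDw v hv]
      obtain ⟨u, hu, hu'⟩ := hdom v hv z' (by rw [← hz', ← h1]; exact hz)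
      refine ⟨u, hu, ?_⟩
      have h2 : f u ≠ f w := by rw [hu', ← hz']; exact hne z
      simp only [f', h2, if_false]
      rw [hu', ← hz']

lemma c4 {V : Type*} (G : SimpleGraph V) (h4 : NoFourCycle G) {a c b b' : V} (hac : a ≠ c)
    (h1 : G.Adj a b) (h2 : G.Adj c b) (h3 : G.Adj a b') (h5 : G.Adj c b') : b = b' := by
  by_contra hb
  refine h4 a (.cons h1 (.cons h2.symm (.cons h5 (.cons h3.symm .nil)))) ?_ rfl
  rw [Walk.isCycle_def]
  have := h1.ne
  have := h2.ne
  have := h3.ne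
  have := h5.ne
  refine ⟨?_, by simp, ?_⟩
  · rw [Walk.isTrail_def]
    simp [Sym2.eq_iff]
    grind
  · simp
    grind

/-- Neighbours of `y` outside the closed neighbourhood of `x`. -/
def S {V : Type*} (G : SimpleGraph V) (x y : V) : Set V := {v | G.Adj y v ∧ v ≠ x ∧ ¬ G.Adj x v}

/-- `f` is a good partial coloring for `T`. -/
def P {V : Type*} (G : SimpleGraph V) (x : V) (T : Finset V) (f : V → V) : Prop :=
  (∀ y ∈ T, ∀ v ∈ S G x y, f v ∈ S G y x) ∧ (∀ y ∈ T, Set.InjOn f (S G x y)) ∧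
  ∀ y ∈ T, ∀ z ∈ T, ∀ u ∈ S G x y, ∀ v ∈ S G x z, G.Adj u v → f u ≠ f v

open Classical in
lemma card_S {V : Type*} [Fintype V] (G : SimpleGraph V) [DecidableRel G.Adj] (d : ℕ)
    (hreg : G.IsRegularOfDegree d) (h4 : NoFourCycle G) {x y : V} (hxy : G.Adj x y) :
    (S G x y).toFinset.card = (S G y x).toFinset.card ∧ d ≤ (S G x y).toFinset.card + 2 := by
  have key : ∀ x y, G.Adj x y →
      (S G x y).toFinset.card + 1 + (G.neighborFinset x ∩ G.neighborFinset y).card = d := by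
    intro x y hxy
    rw [← hreg y, ← G.card_neighborFinset_eq_degree]
    have h1 : G.neighborFinset y = insert x ((S G x y).toFinset ∪
        (G.neighborFinset x ∩ G.neighborFinset y)) := by
      ext v
      have := hxy.symm
      simp [S]
      grind
    have h2 : x ∉ (S G x y).toFinset ∪ (G.neighborFinset x ∩ G.neighborFinset y) := by
      simp only [Finset.mem_union, Set.mem_toFinset, Finset.mem_inter, mem_neighborFinset]
      rintro (h | h)
      · exact h.2.1 rfl
      · exact h.1.ne rfl
    have h3 : Disjoint (S G x y).toFinset (G.neighborFinset x ∩ G.neighborFinset y) := by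
      rw [Finset.disjoint_left]
      intro v hv hv'
      rw [Set.mem_toFinset] at hv
      simp only [Finset.mem_inter, mem_neighborFinset] at hv'
      exact hv.2.2 hv'.1
    conv_rhs => rw [h1]
    rw [Finset.card_insert_of_notMem h2, Finset.card_union_of_disjoint h3]
    omega
  have h1 := key x y hxy
  have h2 := key y x hxy.symm
  rw [Finset.inter_comm] at h2
  have h3 : (G.neighborFinset x ∩ G.neighborFinset y).card ≤ 1 := by
    rw [Finset.card_le_one]
    intro a ha b hb
    simp at ha hb
    exact c4 G h4 hxy.ne ha.1 ha.2 hb.1 hb.2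
  omega

open Classical in
lemma step {V : Type*} [Fintype V] (G : SimpleGraph V) [DecidableRel G.Adj] (d : ℕ)
    (hreg : G.IsRegularOfDegree d) (h4 : NoFourCycle G) {x y : V} (hxy : G.Adj x y)
    (T : Finset V) (hT : ∀ z ∈ T, G.Adj x z) (hyT : y ∉ T) (q : ℕ) (hq : 2 * q + 2 ≤ d)
    (hTq : (T.filter (fun z => ¬ G.Adj y z)).card ≤ q) (f : V → V) (hf : P G x T f) :
    ∃ f', P G x (insert y T) f' := by
  obtain ⟨hf1, hf2, hf3⟩ := hf
  obtain ⟨hc, hd⟩ := card_S G d hreg h4 hxy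
  have hnz : ∀ s ∈ S G x y, ∀ z ∈ T, ∀ u ∈ S G x z, G.Adj s u → ¬ G.Adj y z := by
    rintro s ⟨hs1, hs2, hs3⟩ z hz u ⟨hu1, hu2, hu3⟩ hsu hyz
    have hzs : z ≠ s := by rintro rfl; exact hs3 (hT z hz)
    have : y = u := c4 G h4 hzs hyz.symm hs1.symm hu1 hsu
    subst this
    exact hu3 hxy
  obtain ⟨forb, hforb⟩ : ∃ forb : V → V → Prop, ∀ s c, forb s c ↔
      ∃ z ∈ T, ∃ u ∈ S G x z, G.Adj s u ∧ f u = c := ⟨_, fun _ _ => Iff.rfl⟩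
  obtain ⟨g, hg1, hg2⟩ := hall (S G x y).toFinset (S G y x).toFinset
    forb q hc (by omega)
    (by
      intro s hs
      rw [Set.mem_toFinset] at hs
      refine le_trans (Finset.card_le_card_of_forall_subsingleton
        (fun c z => ∃ u ∈ S G x z, G.Adj s u ∧ f u = c) ?_ ?_) hTq
      · intro c hc
        obtain ⟨z, hz, u, hu, hsu, hfu⟩ := (hforb _ _).1 (Finset.mem_filter.1 hc).2
        exact ⟨z, Finset.mem_filter.2 ⟨hz, hnz s hs z hz u hu hsu⟩, u, hu, hsu, hfu⟩
      · rintro z hz c ⟨-, u, hu, hsu, rfl⟩ c' ⟨-, u', hu', hsu', rfl⟩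
        have hz' := (Finset.mem_filter.1 hz).1
        have hzs : z ≠ s := by rintro rfl; exact hs.2.2 (hT z hz')
        rw [c4 G h4 hzs hu.1 hsu hu'.1 hsu'])
    (by
      intro c hc
      refine le_trans (Finset.card_le_card_of_forall_subsingleton
        (fun s z => ∃ u ∈ S G x z, G.Adj s u ∧ f u = c) ?_ ?_) hTq
      · intro s hs
        obtain ⟨z, hz, u, hu, hsu, hfu⟩ := (hforb _ _).1 (Finset.mem_filter.1 hs).2
        replace hs := (Finset.mem_filter.1 hs).1
        rw [Set.mem_toFinset] at hs
        exact ⟨z, Finset.mem_filter.2 ⟨hz, hnz s hs z hz u hu hsu⟩, u, hu, hsu, hfu⟩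
      · rintro z hz s ⟨hs, u, hu, hsu, hfu⟩ s' ⟨hs', u', hu', hsu', hfu'⟩
        have hz' := (Finset.mem_filter.1 hz).1
        have hs := (Finset.mem_filter.1 hs).1
        have hs' := (Finset.mem_filter.1 hs').1
        rw [Set.mem_toFinset] at hs hs'
        have : u = u' := hf2 z hz' hu hu' (hfu.trans hfu'.symm)
        subst this
        have hyu : y ≠ u := by rintro rfl; exact hu.2.2 hxy
        exact c4 G h4 hyu hs.1 hsu.symm hs'.1 hsu'.symm)
  simp only [Set.mem_toFinset, Set.coe_toFinset] at hg1 hg2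
  have hdisj : ∀ z ∈ T, ∀ v ∈ S G x z, v ∉ S G x y := by
    intro z hz v hv hv'
    have : z = y := c4 G h4 hv.2.1.symm (hT z hz) hv.1.symm hxy hv'.1.symm
    subst this
    exact hyT hz
  refine ⟨fun v => if v ∈ S G x y then g v else f v, ?_, ?_, ?_⟩
  · intro z hz v hv
    rcases Finset.mem_insert.1 hz with rfl | hz
    · simpa [hv] using (hg1 v hv).1
    · simpa [hdisj z hz v hv] using hf1 z hz v hv
  · intro z hz u hu v hv huv
    rcases Finset.mem_insert.1 hz with rfl | hz
    · simp only [hu, hv, if_true] at huv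
      exact hg2 hu hv huv
    · simp only [hdisj z hz u hu, hdisj z hz v hv, if_false] at huv
      exact hf2 z hz hu hv huv
  · intro z hz z' hz' u hu v hv huv
    rcases Finset.mem_insert.1 hz with rfl | hz1 <;> rcases Finset.mem_insert.1 hz' with rfl | hz1'
    · simp only [hu, hv, if_true]
      intro h
      exact huv.ne (hg2 hu hv h)
    · simp only [hu, hdisj z' hz1' v hv, if_true, if_false]
      intro h
      exact (hg1 u hu).2 ((hforb _ _).2 ⟨z', hz1', v, hv, huv, h.symm⟩)
    · simp only [hv, hdisj z hz1 u hu, if_true, if_false]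
      intro h
      exact (hg1 v hv).2 ((hforb _ _).2 ⟨z, hz1, u, hu, huv.symm, h⟩)
    · simp only [hdisj z hz1 u hu, hdisj z' hz1' v hv, if_false]
      exact hf3 z hz1 z' hz1' u hu v hv huv

open Classical in
lemma steps {V : Type*} [Fintype V] (G : SimpleGraph V) [DecidableRel G.Adj] (d : ℕ)
    (hreg : G.IsRegularOfDegree d) (h4 : NoFourCycle G) {x : V}
    (T : Finset V) (hT : ∀ z ∈ T, G.Adj x z) (hcard : 2 * T.card ≤ d) :
    ∃ f, P G x T f := by
  induction T using Finset.induction_on with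
  | empty => exact ⟨id, by simp [P]⟩
  | insert y T hy ih =>
    rw [Finset.card_insert_of_notMem hy] at hcard
    obtain ⟨f, hf⟩ := ih (fun z hz => hT z (Finset.mem_insert_of_mem hz)) (by omega)
    exact step G d hreg h4 (hT y (Finset.mem_insert_self _ _)) T
      (fun z hz => hT z (Finset.mem_insert_of_mem hz)) hy T.card (by omega)
      (Finset.card_filter_le _ _) f hf

open Classical in
lemma final {V : Type*} [Fintype V] (G : SimpleGraph V) [DecidableRel G.Adj] (d : ℕ)
    (hreg : G.IsRegularOfDegree d) (h4 : NoFourCycle G) {x : V}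
    (T : Finset V) (hT : ∀ z ∈ T, G.Adj x z) (f : V → V) (hf : P G x T f) :
    ∃ k, T.card + 1 ≤ k ∧ ∃ C : V → Fin k, IsBColoring G k C := by
  obtain ⟨hf1, hf2, hf3⟩ := hf
  have hxT : x ∉ T := fun h => (hT x h).ne rfl
  let K : Finset V := insert x (G.neighborFinset x)
  have hmK : ∀ v, v ∈ K ↔ v = x ∨ G.Adj x v := by intro v; simp [K]
  have hKc : K.card = d + 1 := by
    rw [Finset.card_insert_of_notMem (by simp), G.card_neighborFinset_eq_degree, hreg x]
  let f0 : V → V := fun v => if v ∈ K then v else f v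
  let W : Set V := {v | v ∈ K ∨ ∃ y ∈ T, v ∈ S G x y}
  have hSK : ∀ y, ∀ v ∈ S G x y, v ∉ K := by
    intro y v hv h
    rcases (hmK v).1 h with h | h
    · exact hv.2.1 h
    · exact hv.2.2 h
  have mixed : ∀ u ∈ K, ∀ y ∈ T, ∀ v ∈ S G x y, G.Adj u v → u ≠ f v := by
    intro u hu y hy v hv huv h
    rcases (hmK u).1 hu with rfl | hu
    · exact hv.2.2 huv
    · have : u = y := c4 G h4 hv.2.1.symm hu huv.symm (hT y hy) hv.1.symm
      subst this
      exact (hf1 u hy v hv).2.1 h.symm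
  obtain ⟨F, hF1, hF2, hF3⟩ := greedy G d hreg K (by omega) W f0
    (by
      rintro v (hv | ⟨y, hy, hv⟩)
      · simpa [f0, hv] using hv
      · simp only [f0, hSK y v hv, if_false]
        exact (hmK _).2 (Or.inr (hf1 y hy v hv).1))
    (by
      rintro u (hu | ⟨y, hy, hu⟩) v (hv | ⟨z, hz, hv⟩) huv
      · simpa [f0, hu, hv] using huv.ne
      · simp only [f0, hu, hSK z v hv, if_true, if_false]
        exact mixed u hu z hz v hv huv
      · simp only [f0, hv, hSK y u hu, if_true, if_false]
        exact (mixed v hv y hy u hu huv.symm).symm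
      · simp only [f0, hSK y u hu, hSK z v hv, if_false]
        exact hf3 y hy z hz u hu v hv huv) Finset.univ
  have hFK : ∀ v ∈ K, F v = v := by
    intro v hv
    rw [hF1 v (Or.inl hv)]
    simp [f0, hv]
  have hFS : ∀ y ∈ T, ∀ v ∈ S G x y, F v = f v := by
    intro y hy v hv
    rw [hF1 v (Or.inr ⟨y, hy, hv⟩)]
    simp [f0, hSK y v hv]
  have hDK : ∀ v ∈ insert x T, v ∈ K := by
    intro v hv
    rcases Finset.mem_insert.1 hv with rfl | hv
    · exact (hmK _).2 (Or.inl rfl)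
    · exact (hmK _).2 (Or.inr (hT v hv))
  have := reduce G (insert x T) _ F rfl (fun u v => hF3 u v (by simp) (by simp))
    (by
      intro u hu v hv huv
      rwa [hFK u (hDK u hu), hFK v (hDK v hv)] at huv)
    (by
      intro v hv w hw
      have hcK : F w ∈ K := hF2 w (by simp)
      generalize F w = c at hw hcK
      rw [hFK v (hDK v hv)] at hw
      rcases Finset.mem_insert.1 hv with rfl | hv
      · rcases (hmK c).1 hcK with h | h
        · exact absurd h hw
        · exact ⟨c, h, hFK c hcK⟩
      · by_cases hvc : G.Adj v c
        · exact ⟨c, hvc, hFK c hcK⟩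
        have hxv := hT v hv
        have hcS : c ∈ S G v x := by
          refine ⟨?_, hw, hvc⟩
          rcases (hmK c).1 hcK with rfl | h
          · exact absurd hxv.symm hvc
          · exact h
        have himg : (S G x v).toFinset.image f = (S G v x).toFinset := by
          apply Finset.eq_of_subset_of_card_le
          · intro b hb
            obtain ⟨a, ha, rfl⟩ := Finset.mem_image.1 hb
            rw [Set.mem_toFinset] at ha ⊢
            exact hf1 v hv a ha
          · rw [Finset.card_image_of_injOn (by simpa using hf2 v hv)]
            exact (card_S G d hreg h4 hxv).1.ge
        have : c ∈ (S G x v).toFinset.image f := by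
          rw [himg, Set.mem_toFinset]; exact hcS
        obtain ⟨u, hu, rfl⟩ := Finset.mem_image.1 this
        rw [Set.mem_toFinset] at hu
        exact ⟨u, hu.1, hFS v hv u hu⟩)
  rwa [Finset.card_insert_of_notMem hxT] at this

end BChrom

/-- Every `d`-regular graph with no 4-cycle containing a triangle has b-chromatic number
at least `⌊(d+4)/2⌋`. -/
theorem bChromatic_ge_of_noFourCycle_triangle
    {V : Type*} [Fintype V] (G : SimpleGraph V) [DecidableRel G.Adj] (d : ℕ)
    (hreg : G.IsRegularOfDegree d) (h4 : NoFourCycle G)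
    (htri : ∃ a b c : V, G.Adj a b ∧ G.Adj b c ∧ G.Adj a c) :
    (d + 4) / 2 ≤ bChromaticNumber G := by
  classical
  obtain ⟨x, b, c, hxb, hbc, hxc⟩ := htri
  have hsub : ({b, c} : Finset V) ⊆ G.neighborFinset x := by
    intro v hv
    simp only [Finset.mem_insert, Finset.mem_singleton] at hv
    rcases hv with rfl | rfl <;> simpa
  have h2 : ({b, c} : Finset V).card = 2 := Finset.card_pair hbc.ne
  have hN : (G.neighborFinset x).card = d := by
    rw [G.card_neighborFinset_eq_degree, hreg x]
  have hd : 2 ≤ d := by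
    have := Finset.card_le_card hsub
    omega
  have hcard : (G.neighborFinset x \ {b, c}).card = d - 2 := by
    rw [Finset.card_sdiff_of_subset hsub, h2, hN]
  obtain ⟨T0, hT0, hT0c⟩ := Finset.exists_subset_card_eq
    (s := G.neighborFinset x \ {b, c}) (n := d / 2 - 1) (by omega)
  have hT0' : ∀ z ∈ T0, G.Adj x z ∧ z ≠ b ∧ z ≠ c := by
    intro z hz
    have := hT0 hz
    simpa using this
  have hb : b ∉ T0 := fun h => (hT0' b h).2.1 rfl
  have hc : c ∉ insert b T0 := by
    intro h
    rcases Finset.mem_insert.1 h with h | h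
    · exact hbc.ne h.symm
    · exact (hT0' c h).2.2 rfl
  have hTb : ∀ z ∈ insert b T0, G.Adj x z := by
    intro z hz
    rcases Finset.mem_insert.1 hz with rfl | h
    · exact hxb
    · exact (hT0' z h).1
  have hTc : ∀ z ∈ insert c (insert b T0), G.Adj x z := by
    intro z hz
    rcases Finset.mem_insert.1 hz with rfl | h
    · exact hxc
    · exact hTb z h
  have hcb : (insert b T0).card = d / 2 := by
    rw [Finset.card_insert_of_notMem hb]; omega
  obtain ⟨f, hf⟩ := BChrom.steps G d hreg h4 (insert b T0) hTb (by omega)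
  obtain ⟨f', hf'⟩ := BChrom.step G d hreg h4 hxc (insert b T0) hTb hc (d / 2 - 1) (by omega)
    (by
      rw [← hT0c]
      apply Finset.card_le_card
      intro z hz
      obtain ⟨hz, hz'⟩ := Finset.mem_filter.1 hz
      rcases Finset.mem_insert.1 hz with rfl | h
      · exact absurd hbc.symm hz'
      · exact h) f hf
  obtain ⟨k, hk, C, hC⟩ := BChrom.final G d hreg h4 _ hTc f' hf'
  rw [Finset.card_insert_of_notMem hc, hcb] at hk
  have hle : k ≤ bChromaticNumber G := by
    apply le_csSup
    · refine ⟨Fintype.card V, ?_⟩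
      rintro k ⟨C, hC⟩
      have hs : Function.Surjective C := fun c => (hC.2 c).imp fun v hv => hv.1
      simpa using Fintype.card_le_of_surjective C hs
    · exact ⟨C, hC⟩
  omega
end

section
/- Let G be a d-regular simple graph that contains no cycle of length 4 (as a subgraph). If there exists a vertex v of G such that for every edge {u, v} incident with v, the number of 5-cycles of G that contain the edge {u, v} is at most (d-2)/2, then φ(G) = d + 1. -/
open SimpleGraph

/-- `C` is a 5-cycle of `G`, represented as the subgraph of some cycle walk of length 5. -/
def IsFiveCycle {V : Type*} (G : SimpleGraph V) (C : G.Subgraph) : Prop :=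
  ∃ (a : V) (w : G.Walk a a), w.IsCycle ∧ w.length = 5 ∧ C = w.toSubgraph

section helpers

lemma noC4 {V : Type*} {G : SimpleGraph V} (h4 : NoFourCycle G) {a b x y : V}
    (hab : a ≠ b) (hxy : x ≠ y) (h1 : G.Adj a x) (h2 : G.Adj b x) (h3 : G.Adj a y)
    (h4' : G.Adj b y) : False := by
  refine h4 a (.cons h1 (.cons h2.symm (.cons h4' (.cons h3.symm .nil)))) ?_ rfl
  have := h1.ne; have := h2.ne; have := h3.ne; have := h4'.ne
  rw [Walk.cons_isCycle_iff]
  simp [Walk.cons_isPath_iff]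
  grind

lemma hall_lemma {V : Type*} [DecidableEq V] (A B : Finset V) (F : Finset (V × V))
    (hAB : A.card = B.card) (hF : F.card < A.card ∨ A.card = 0) :
    ∃ g : V → V, Set.InjOn g A ∧ ∀ x ∈ A, g x ∈ B ∧ (x, g x) ∉ F := by
  classical
  let t : A → Finset V := fun x => B.filter (fun b => ((x : V), b) ∉ F)
  have key : ∀ s : Finset A, s.card ≤ (s.biUnion t).card := by
    intro s
    by_contra hlt
    push Not at hlt
    have hsub : s.biUnion t ⊆ B := by
      intro b; simp only [Finset.mem_biUnion]; rintro ⟨x, -, hb⟩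
      exact (Finset.mem_filter.1 hb).1
    have hsA : s.card ≤ A.card := by
      simpa using Finset.card_le_univ s
    have hc : (B \ s.biUnion t).card + (s.biUnion t).card = B.card :=
      Finset.card_sdiff_add_card_eq_card hsub
    have hle : ((s.map (Function.Embedding.subtype _)) ×ˢ (B \ s.biUnion t)).card ≤ F.card := by
      apply Finset.card_le_card
      rintro ⟨x, b⟩ h
      rw [Finset.mem_product] at h
      obtain ⟨h1, h2⟩ := h
      rw [Finset.mem_map] at h1
      obtain ⟨x', hx', hxx⟩ := h1
      rw [Finset.mem_sdiff] at h2
      by_contra hn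
      apply h2.2
      rw [Finset.mem_biUnion]
      refine ⟨x', hx', Finset.mem_filter.2 ⟨h2.1, ?_⟩⟩
      have : (x' : V) = x := hxx
      rw [this]; exact hn
    rw [Finset.card_product, Finset.card_map] at hle
    rcases hF with hF | hF
    · obtain ⟨a, ha⟩ : ∃ a, s.card = a + 1 := ⟨s.card - 1, by omega⟩
      obtain ⟨r, hr⟩ : ∃ r, (B \ s.biUnion t).card = r + 1 :=
        ⟨(B \ s.biUnion t).card - 1, by omega⟩
      rw [ha, hr] at hle
      have : (a + 1) * (r + 1) = a * r + a + r + 1 := by ring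
      have : 0 ≤ a * r := Nat.zero_le _
      omega
    · omega
  obtain ⟨g, hg, hgt⟩ := (Finset.all_card_le_biUnion_card_iff_exists_injective t).1 key
  refine ⟨fun x => if h : x ∈ A then g ⟨x, h⟩ else x, ?_, ?_⟩
  · intro x hx y hy hxy
    have hx' : x ∈ A := hx
    have hy' : y ∈ A := hy
    simp only [hx', hy', dif_pos] at hxy
    simpa using hg hxy
  · intro x hx
    simp only [hx, dif_pos]
    exact Finset.mem_filter.1 (hgt ⟨x, hx⟩)

lemma greedy {V : Type*} [Fintype V] [DecidableEq V] (G : SimpleGraph V) [DecidableRel G.Adj]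
    (d : ℕ) (hreg : G.IsRegularOfDegree d) (K : Finset V) (hK : K.card = d + 1)
    (D : Finset V) (c : V → V) (hcK : ∀ x ∈ D, c x ∈ K)
    (hc : ∀ x ∈ D, ∀ y ∈ D, G.Adj x y → c x ≠ c y) :
    ∃ c' : V → V, (∀ x ∈ D, c' x = c x) ∧ (∀ x, c' x ∈ K) ∧ ∀ x y, G.Adj x y → c' x ≠ c' y := by
  suffices h : ∀ S : Finset V, ∃ c' : V → V, (∀ x ∈ D, c' x = c x) ∧ (∀ x ∈ D ∪ S, c' x ∈ K) ∧
      ∀ x ∈ D ∪ S, ∀ y ∈ D ∪ S, G.Adj x y → c' x ≠ c' y by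
    obtain ⟨c', h1, h2, h3⟩ := h Finset.univ
    exact ⟨c', h1, fun x => h2 x (by simp), fun x y => h3 x (by simp) y (by simp)⟩
  intro S
  induction S using Finset.induction_on with
  | empty => exact ⟨c, fun _ _ => rfl, by simpa using hcK, by simpa using hc⟩
  | insert a S ha ih =>
    obtain ⟨c', h1, h2, h3⟩ := ih
    by_cases haD : a ∈ D
    · refine ⟨c', h1, ?_, ?_⟩
      · intro x hx; apply h2; grind
      · intro x hx y hy; apply h3 <;> grind
    · obtain ⟨k, hk, hk'⟩ : ∃ k ∈ K, k ∉ (G.neighborFinset a).image c' := by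
        apply Finset.exists_mem_notMem_of_card_lt_card
        have := Finset.card_image_le (s := G.neighborFinset a) (f := c')
        rw [G.card_neighborFinset_eq_degree, hreg a] at this
        omega
      have hk2 : ∀ y, G.Adj a y → c' y ≠ k := by
        intro y hy he
        exact hk' (Finset.mem_image.2 ⟨y, by simpa using hy, he⟩)
      refine ⟨fun x => if x = a then k else c' x, ?_, ?_, ?_⟩
      · intro x hx; grind
      · intro x hx; grind
      · intro x hx y hy hxy
        have := hxy.ne
        have := hxy.symm
        grind

/-- five-cycles through an edge are determined by an edge of the second neighbourhood -/
lemma fiveCycle_exists {V : Type*} (G : SimpleGraph V) {v u x y w : V}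
    (h1 : G.Adj v u) (h2 : G.Adj u x) (h3 : G.Adj x y) (h4 : G.Adj y w) (h5 : G.Adj w v)
    (hvx : v ≠ x) (hvy : v ≠ y) (huy : u ≠ y) (huw : u ≠ w) (hxw : x ≠ w) :
    ∃ C : G.Subgraph, (IsFiveCycle G C ∧ C.Adj v u) ∧ C.Adj u x ∧ C.Adj x y ∧
      (∀ z, C.Adj u z → z = v ∨ z = x) ∧ (∀ z, C.Adj x z → z = u ∨ z = y) := by
  have := h1.ne; have := h2.ne; have := h3.ne; have := h4.ne; have := h5.ne
  refine ⟨(Walk.cons h1 (.cons h2 (.cons h3 (.cons h4 (.cons h5 .nil))))).toSubgraph,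
    ⟨⟨v, _, ?_, rfl, rfl⟩, ?_⟩, ?_, ?_, ?_, ?_⟩
  · rw [Walk.cons_isCycle_iff]
    simp [Walk.cons_isPath_iff]
    grind
  all_goals simp [Walk.toSubgraph]
  all_goals grind

lemma pairs_card {V : Type*} [Fintype V] (G : SimpleGraph V) (v u : V) (P : Finset (V × V))
    (hP : ∀ p ∈ P, ∃ C : G.Subgraph, (IsFiveCycle G C ∧ C.Adj v u) ∧ C.Adj u p.1 ∧ C.Adj p.1 p.2 ∧
      (∀ z, C.Adj u z → z = v ∨ z = p.1) ∧ (∀ z, C.Adj p.1 z → z = u ∨ z = p.2))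
    (hP2 : ∀ p ∈ P, p.1 ≠ v ∧ p.2 ≠ u) :
    P.card ≤ {C : G.Subgraph | IsFiveCycle G C ∧ C.Adj v u}.ncard := by
  classical
  have : Finite G.Subgraph := inferInstance
  choose! Φ h0 h1 h2 h3 h4 using hP
  rw [← Set.ncard_coe_finset]
  apply Set.ncard_le_ncard_of_injOn Φ
  · intro p hp; exact h0 p hp
  · intro p hp q hq hpq
    have hp' : p ∈ P := hp
    have hq' : q ∈ P := hq
    have e1 : q.1 = p.1 := by
      have := h1 q hq'
      rw [← hpq] at this
      exact (h3 p hp' _ this).resolve_left (hP2 q hq').1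
    have e2 : q.2 = p.2 := by
      have := h2 q hq'
      rw [← hpq, e1] at this
      exact (h4 p hp' _ this).resolve_left (hP2 q hq').2
    exact Prod.ext e1.symm e2.symm

lemma second_nbhd {V : Type*} [Fintype V] [DecidableEq V] (G : SimpleGraph V)
    [DecidableRel G.Adj] (d : ℕ)
    (hreg : G.IsRegularOfDegree d) (h4 : NoFourCycle G)
    (v : V)
    (h5 : ∀ u : V, G.Adj v u →
      (({C : G.Subgraph | IsFiveCycle G C ∧ C.Adj v u}.ncard : ℝ)) ≤ ((d : ℝ) - 2) / 2)
    (A B : V → Finset V)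
    (hA : ∀ u, A u = (G.neighborFinset u \ insert v (G.neighborFinset v)))
    (hB : ∀ u, B u = (G.neighborFinset v \ insert u (G.neighborFinset u)))
    (S : Finset V) (hS : ∀ u ∈ S, G.Adj v u) :
    ∃ f : V → V, (∀ u ∈ S, Set.InjOn f (A u)) ∧ (∀ u ∈ S, ∀ x ∈ A u, f x ∈ B u) ∧
      ∀ u ∈ S, ∀ w ∈ S, ∀ x ∈ A u, ∀ y ∈ A w, G.Adj x y → f x ≠ f y := by
  have mA : ∀ u x, x ∈ A u ↔ G.Adj u x ∧ x ≠ v ∧ ¬ G.Adj v x := by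
    intro u x; rw [hA]; simp
  induction S using Finset.induction_on with
  | empty => exact ⟨id, by simp, by simp, by simp⟩
  | insert u S hu ih =>
    obtain ⟨f, f1, f2, f3⟩ := ih (fun w hw => hS w (Finset.mem_insert_of_mem hw))
    have hvu : G.Adj v u := hS u (Finset.mem_insert_self _ _)
    have hSv : ∀ w ∈ S, G.Adj v w := fun w hw => hS w (Finset.mem_insert_of_mem hw)
    let P : Finset (V × V) := Finset.univ.filter (fun p => p.1 ∈ A u ∧ G.Adj p.1 p.2 ∧
      ∃ w ∈ S, p.2 ∈ A w)
    have disj : ∀ a b x, G.Adj v a → G.Adj v b → x ∈ A a → x ∈ A b → a = b := by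
      intro a b x ha hb hxa hxb
      by_contra hab
      rw [mA] at hxa hxb
      exact noC4 h4 hab hxa.2.1 hxa.1 hxb.1 ha.symm hb.symm
    have hPc : P.card ≤ {C : G.Subgraph | IsFiveCycle G C ∧ C.Adj v u}.ncard := by
      apply pairs_card
      · rintro ⟨x, y⟩ hp
        obtain ⟨hx, hxy, w, hw, hy⟩ := (Finset.mem_filter.1 hp).2
        simp only at hx hxy hy ⊢
        rw [mA] at hx hy
        have hvw := hSv w hw
        refine fiveCycle_exists G hvu hx.1 hxy hy.1.symm hvw.symm hx.2.1.symm hy.2.1.symm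
          ?_ ?_ ?_
        · rintro rfl; exact hy.2.2 hvu
        · rintro rfl; exact hu hw
        · rintro rfl; exact hx.2.2 hvw
      · rintro ⟨x, y⟩ hp
        obtain ⟨hx, hxy, w, hw, hy⟩ := (Finset.mem_filter.1 hp).2
        simp only at hx hxy hy ⊢
        rw [mA] at hx hy
        refine ⟨hx.2.1, ?_⟩
        rintro rfl; exact hy.2.2 hvu
    have hd : 2 * P.card + 2 ≤ d := by
      have := h5 u hvu
      have h' : (P.card : ℝ) ≤ ({C : G.Subgraph | IsFiveCycle G C ∧ C.Adj v u}.ncard : ℝ) := by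
        exact_mod_cast hPc
      have : (2 * P.card + 2 : ℝ) ≤ d := by linarith
      exact_mod_cast this
    have hI : (G.neighborFinset u ∩ G.neighborFinset v).card ≤ 1 := by
      rw [Finset.card_le_one]
      intro a ha b hb
      by_contra hab
      simp only [Finset.mem_inter, mem_neighborFinset] at ha hb
      exact noC4 h4 hvu.ne hab ha.2 ha.1 hb.2 hb.1
    have hAc : (A u).card + (G.neighborFinset u ∩ G.neighborFinset v).card + 1 = d := by
      have e1 := Finset.card_sdiff_add_card_inter (G.neighborFinset u)
        (insert v (G.neighborFinset v))
      rw [← hA, G.card_neighborFinset_eq_degree, hreg u,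
        Finset.inter_insert_of_mem (by simpa using hvu.symm),
        Finset.card_insert_of_notMem (by simp)] at e1
      omega
    have hBc : (B u).card + (G.neighborFinset u ∩ G.neighborFinset v).card + 1 = d := by
      have e1 := Finset.card_sdiff_add_card_inter (G.neighborFinset v)
        (insert u (G.neighborFinset u))
      rw [← hB, G.card_neighborFinset_eq_degree, hreg v,
        Finset.inter_insert_of_mem (by simpa using hvu),
        Finset.card_insert_of_notMem (by simp), Finset.inter_comm] at e1
      omega
    obtain ⟨g, g1, g2⟩ := hall_lemma (A u) (B u) (P.image (fun p => (p.1, f p.2)))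
      (by omega) (by
        have := Finset.card_image_le (s := P) (f := fun p => (p.1, f p.2))
        omega)
    have hnot : ∀ w ∈ S, ∀ x ∈ A w, x ∉ A u := by
      intro w hw x hx hxu
      have := disj w u x (hSv w hw) hvu hx hxu
      subst this; exact hu hw
    have hcross : ∀ w ∈ S, ∀ x ∈ A u, ∀ y ∈ A w, G.Adj x y → g x ≠ f y := by
      intro w hw x hx y hy hxy he
      apply (g2 x hx).2
      rw [he]
      exact Finset.mem_image.2 ⟨(x, y),
        Finset.mem_filter.2 ⟨Finset.mem_univ _, hx, hxy, w, hw, hy⟩, rfl⟩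
    have vu : ∀ x ∈ A u, (if x ∈ A u then g x else f x) = g x := fun x hx => if_pos hx
    have vw : ∀ w ∈ S, ∀ x ∈ A w, (if x ∈ A u then g x else f x) = f x :=
      fun w hw x hx => if_neg (hnot w hw x hx)
    refine ⟨fun x => if x ∈ A u then g x else f x, ?_, ?_, ?_⟩
    · intro w hw x hx y hy hxy
      have hx' : x ∈ A w := hx
      have hy' : y ∈ A w := hy
      rcases Finset.mem_insert.1 hw with rfl | hw
      · simp only [vu x hx', vu y hy'] at hxy
        exact g1 hx hy hxy
      · simp only [vw w hw x hx', vw w hw y hy'] at hxy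
        exact f1 w hw hx hy hxy
    · intro w hw x hx
      rcases Finset.mem_insert.1 hw with rfl | hw
      · simp only [vu x hx]; exact (g2 x hx).1
      · simp only [vw w hw x hx]; exact f2 w hw x hx
    · intro a ha b hb x hx y hy hxy
      rcases Finset.mem_insert.1 ha with ha' | ha' <;>
        rcases Finset.mem_insert.1 hb with hb' | hb' <;> clear ha hb <;>
        rename' ha' => ha, hb' => hb <;> try subst ha
      all_goals try subst hb
      · simp only [vu x hx, vu y hy]
        exact fun he => hxy.ne (g1 hx hy he)
      · simp only [vu x hx, vw b hb y hy]
        exact hcross b hb x hx y hy hxy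
      · simp only [vu y hy, vw a ha x hx]
        exact (hcross a ha y hy x hx hxy.symm).symm
      · simp only [vw a ha x hx, vw b hb y hy]
        exact f3 a ha b hb x hx y hy hxy

end helpers

/-- If `G` is `d`-regular with no 4-cycle, and some vertex `v` is such that every edge at `v`
lies on at most `(d-2)/2` five-cycles, then `φ(G) = d + 1`. -/
theorem bChromatic_eq_of_few_fiveCycles_on_edges
    {V : Type*} [Fintype V] (G : SimpleGraph V) [DecidableRel G.Adj] (d : ℕ)
    (hreg : G.IsRegularOfDegree d) (h4 : NoFourCycle G)
    (v : V)
    (h5 : ∀ u : V, G.Adj v u →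
      (({C : G.Subgraph | IsFiveCycle G C ∧ C.Adj v u}.ncard : ℝ)) ≤ ((d : ℝ) - 2) / 2) :
    bChromaticNumber G = d + 1 := by
  classical
  have hub : ∀ k ∈ {k : ℕ | ∃ C : V → Fin k, IsBColoring G k C}, k ≤ d + 1 := by
    rintro k ⟨C, -, hC⟩
    rcases Nat.eq_zero_or_pos k with rfl | hk
    · omega
    obtain ⟨z, hz, hz'⟩ := hC ⟨0, hk⟩
    have hsub : (Finset.univ : Finset (Fin k)) ⊆
        insert (C z) ((G.neighborFinset z).image C) := by
      intro c _
      by_cases hc : c = C z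
      · simp [hc]
      · obtain ⟨y, hy, rfl⟩ := hz' c (by rw [← hz]; exact hc)
        apply Finset.mem_insert_of_mem
        exact Finset.mem_image.2 ⟨y, by simpa using hy, rfl⟩
    have e1 := Finset.card_le_card hsub
    have e2 := Finset.card_insert_le (C z) ((G.neighborFinset z).image C)
    have e3 := Finset.card_image_le (s := G.neighborFinset z) (f := C)
    rw [G.card_neighborFinset_eq_degree, hreg z] at e3
    simp only [Finset.card_univ, Fintype.card_fin] at e1
    omega
  refine IsGreatest.csSup_eq ⟨?_, hub⟩
  let A : V → Finset V := fun u => G.neighborFinset u \ insert v (G.neighborFinset v)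
  let B : V → Finset V := fun u => G.neighborFinset v \ insert u (G.neighborFinset u)
  have mA : ∀ u x, x ∈ A u ↔ G.Adj u x ∧ x ≠ v ∧ ¬ G.Adj v x := by
    intro u x; simp [A]
  have mB : ∀ u x, x ∈ B u ↔ G.Adj v x ∧ x ≠ u ∧ ¬ G.Adj u x := by
    intro u x; simp [B]
  obtain ⟨f, f1, f2, f3⟩ := second_nbhd G d hreg h4 v h5 A B (fun _ => rfl) (fun _ => rfl)
    (G.neighborFinset v) (by simp)
  simp only [mem_neighborFinset] at f1 f2 f3
  have hAB : ∀ u, G.Adj v u → (B u).card ≤ (A u).card := by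
    intro u hvu
    have e1 := Finset.card_sdiff_add_card_inter (G.neighborFinset v)
      (insert u (G.neighborFinset u))
    have e2 := Finset.card_sdiff_add_card_inter (G.neighborFinset u)
      (insert v (G.neighborFinset v))
    rw [G.card_neighborFinset_eq_degree, hreg v,
      Finset.inter_insert_of_mem (by simpa using hvu),
      Finset.card_insert_of_notMem (by simp), Finset.inter_comm] at e1
    rw [G.card_neighborFinset_eq_degree, hreg u,
      Finset.inter_insert_of_mem (by simpa using hvu.symm),
      Finset.card_insert_of_notMem (by simp)] at e2
    simp only [A, B]
    omega
  have fsurj : ∀ u, G.Adj v u → ∀ b ∈ B u, ∃ x ∈ A u, f x = b := by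
    intro u hu b hb
    have := Finset.surjOn_of_injOn_of_card_le f (fun x hx => f2 u hu x hx) (f1 u hu) (hAB u hu)
    obtain ⟨x, hx, he⟩ := this hb
    exact ⟨x, hx, he⟩
  let K : Finset V := insert v (G.neighborFinset v)
  have hK : K.card = d + 1 := by
    simp only [K]
    rw [Finset.card_insert_of_notMem (by simp), G.card_neighborFinset_eq_degree, hreg v]
  have mK : ∀ x, x ∈ K ↔ x = v ∨ G.Adj v x := by intro x; simp [K]
  let D : Finset V := K ∪ (G.neighborFinset v).biUnion A
  have mD : ∀ x, x ∈ D ↔ x ∈ K ∨ ∃ u, G.Adj v u ∧ x ∈ A u := by intro x; simp [D]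
  have hAK : ∀ u, ∀ x ∈ A u, x ∉ K := by
    intro u x hx; rw [mA] at hx; rw [mK]; tauto
  -- adjacency between the ball and the second neighbourhood
  have hKA : ∀ k ∈ K, ∀ u, G.Adj v u → ∀ x ∈ A u, G.Adj k x → k ≠ f x := by
    intro k hk u hu x hx hkx he
    have hfx := f2 u hu x hx
    rw [← he, mB] at hfx
    rw [mA] at hx
    exact noC4 h4 hfx.2.1 hx.2.1 hkx hx.1 hfx.1.symm hu.symm
  obtain ⟨c, c1, c2, c3⟩ := greedy G d hreg K hK D (fun x => if x ∈ K then x else f x)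
    (by
      intro x hx
      by_cases hxK : x ∈ K
      · simpa only [hxK, if_true] using hxK
      · simp only [hxK, if_false]
        rcases (mD x).1 hx with h | ⟨u, hu, hxu⟩
        · exact absurd h hxK
        · exact (mK _).2 (Or.inr ((mB _ _).1 (f2 u hu x hxu)).1))
    (by
      intro x hx y hy hxy
      rcases (mD x).1 hx with h | ⟨u, hu, hxu⟩ <;> rcases (mD y).1 hy with h' | ⟨w, hw, hyw⟩
      · simp only [h, h', if_true]; exact hxy.ne
      · simp only [h, hAK w y hyw, if_true, if_false]
        exact hKA x h w hw y hyw hxy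
      · simp only [h', hAK u x hxu, if_true, if_false]
        exact (hKA y h' u hu x hxu hxy.symm).symm
      · simp only [hAK u x hxu, hAK w y hyw, if_false]
        exact f3 u hu w hw x hxu y hyw hxy)
  have cK : ∀ x ∈ K, c x = x := by
    intro x hx
    rw [c1 x ((mD x).2 (Or.inl hx))]; simp [hx]
  have cA : ∀ u, G.Adj v u → ∀ x ∈ A u, c x = f x := by
    intro u hu x hx
    rw [c1 x ((mD x).2 (Or.inr ⟨u, hu, hx⟩))]; simp [hAK u x hx]
  have dom : ∀ k ∈ K, ∀ k' ∈ K, k' ≠ k → ∃ y, G.Adj k y ∧ c y = k' := by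
    intro k hk k' hk' hne
    rcases (mK k).1 hk with rfl | hvk
    · rcases (mK k').1 hk' with rfl | h
      · exact absurd rfl hne
      · exact ⟨k', h, cK k' hk'⟩
    · rcases (mK k').1 hk' with rfl | h
      · exact ⟨k', hvk.symm, cK k' hk'⟩
      · by_cases hkk : G.Adj k k'
        · exact ⟨k', hkk, cK k' hk'⟩
        · obtain ⟨x, hx, he⟩ := fsurj k hvk k' ((mB _ _).2 ⟨h, hne, hkk⟩)
          exact ⟨x, ((mA _ _).1 hx).1, by rw [cA k hvk x hx, he]⟩
  let e : K ≃ Fin (d + 1) := K.equivFinOfCardEq hK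
  refine ⟨fun x => e ⟨c x, c2 x⟩, ?_, ?_⟩
  · intro x y hxy he
    have := e.injective he
    exact c3 x y hxy (by simpa using this)
  · intro i
    refine ⟨(e.symm i : V), ?_, ?_⟩
    · have : (⟨c (e.symm i : V), c2 _⟩ : K) = e.symm i :=
        Subtype.ext (cK _ (e.symm i).2)
      simp only [this, Equiv.apply_symm_apply]
    · intro j hj
      obtain ⟨y, hy, hcy⟩ := dom (e.symm i) (e.symm i).2 (e.symm j) (e.symm j).2 (by
        intro h; exact hj (e.symm.injective (Subtype.ext h)))
      refine ⟨y, hy, ?_⟩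
      have : (⟨c y, c2 y⟩ : K) = e.symm j := Subtype.ext hcy
      simp only [this, Equiv.apply_symm_apply]
end

section
/- Let G be a d-regular simple graph of girth 5. If there exists a vertex v of G such that for every edge {u, v} incident with v, the number of 5-cycles of G that contain the edge {u, v} is at most (d-1)/2, then φ(G) = d + 1. -/
open SimpleGraph

lemma hall_aux {α β : Type*} [DecidableEq α] [DecidableEq β] (X : Finset α) (A : Finset β)
    (hX : X.card = A.card) (F : α → Finset β)
    (h : 2 * ∑ x ∈ X, (F x).card ≤ A.card) :
    ∃ f : X → β, Function.Injective f ∧ ∀ x : X, f x ∈ A ∧ f x ∉ F x := by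
  have key := (Finset.all_card_le_biUnion_card_iff_exists_injective
    (fun x : X => A \ F x)).1 ?_
  · obtain ⟨f, hf, hf2⟩ := key
    exact ⟨f, hf, fun x => by simpa using hf2 x⟩
  · intro s
    by_contra hcon
    push Not at hcon
    set B := s.biUnion (fun x : X => A \ F x) with hB
    have hsub : B ⊆ A := by
      intro b hb
      simp only [hB, Finset.mem_biUnion, Finset.mem_sdiff] at hb
      obtain ⟨_, _, h, _⟩ := hb
      exact h
    have hF : ∀ x ∈ s, A.card - B.card ≤ (F x).card := by
      intro x hx
      rw [← Finset.card_sdiff_of_subset hsub]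
      apply Finset.card_le_card
      intro b hb
      simp only [Finset.mem_sdiff, hB, Finset.mem_biUnion, not_exists, not_and] at hb
      by_contra h'
      exact hb.2 x hx hb.1 h'
    have h1 : s.card * (A.card - B.card) ≤ ∑ x ∈ s, (F x).card := by
      rw [← smul_eq_mul]
      exact Finset.card_nsmul_le_sum _ _ _ hF
    have h2 : ∑ x ∈ s, (F x).card ≤ ∑ x ∈ X, (F x).card := by
      rw [← Finset.sum_coe_sort X (fun x => (F x).card)]
      exact Finset.sum_le_sum_of_subset (Finset.subset_univ s)
    have h3 : s.card ≤ A.card := by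
      rw [← hX]
      simpa using Finset.card_le_univ s
    have h4 : A.card ≤ s.card * (A.card - B.card) := by
      obtain ⟨p, hp⟩ := Nat.exists_eq_add_of_lt hcon
      obtain ⟨q, hq⟩ := Nat.exists_eq_add_of_le h3
      have : A.card - B.card = p + q + 1 := by omega
      rw [this, hq, hp]
      nlinarith [Nat.zero_le (B.card * p), Nat.zero_le (B.card * q), Nat.zero_le (p*p),
        Nat.zero_le (p*q)]
    omega

lemma no_tri {V : Type*} (G : SimpleGraph V) (hg : G.egirth = 5) {a b c : V}
    (h1 : G.Adj a b) (h2 : G.Adj b c) (h3 : G.Adj c a) : False := by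
  have h := (SimpleGraph.le_egirth (G := G) (n := 5)).1 hg.ge a
    (.cons h1 (.cons h2 (.cons h3 .nil)))
    (by
      have := h1.ne; have := h2.ne; have := h3.ne
      simp [SimpleGraph.Walk.isCycle_def, SimpleGraph.Walk.isTrail_def]
      grind)
  simp at h
  exact absurd h (by decide)

lemma no_four {V : Type*} (G : SimpleGraph V) (hg : G.egirth = 5) {a b c e : V}
    (h1 : G.Adj a b) (h2 : G.Adj b c) (h3 : G.Adj c e) (h4 : G.Adj e a) (hac : a ≠ c) :
    b = e := by
  by_contra hbe
  have h := (SimpleGraph.le_egirth (G := G) (n := 5)).1 hg.ge a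
    (.cons h1 (.cons h2 (.cons h3 (.cons h4 .nil))))
    (by
      have := h1.ne; have := h2.ne; have := h3.ne; have := h4.ne
      simp [SimpleGraph.Walk.isCycle_def, SimpleGraph.Walk.isTrail_def]
      grind)
  simp at h
  exact absurd h (by decide)

lemma count_aux {V : Type*} [Fintype V] (G : SimpleGraph V) (hg : G.egirth = 5) (v u : V)
    (hvu : G.Adj v u) (T : Finset (V × V))
    (hT : ∀ p ∈ T, G.Adj u p.1 ∧ p.1 ≠ v ∧ G.Adj p.1 p.2 ∧ p.2 ≠ u ∧
      ∃ w, G.Adj v w ∧ w ≠ u ∧ G.Adj w p.2 ∧ p.2 ≠ v) :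
    T.card ≤ {C : G.Subgraph | IsFiveCycle G C ∧ C.Adj v u}.ncard := by
  classical
  have ex : ∀ p ∈ T, ∃ C : G.Subgraph, (IsFiveCycle G C ∧ C.Adj v u) ∧
      (∀ z, C.Adj u z ↔ z = v ∨ z = p.1) ∧ (∀ z, C.Adj p.1 z ↔ z = u ∨ z = p.2) := by
    rintro ⟨x, y⟩ hp
    obtain ⟨h1, h2, h3, h4, w, h5, h6, h7, h8⟩ := hT _ hp
    simp only at h1 h2 h3 h4 h7 h8 ⊢
    have hxw : x ≠ w := by
      rintro rfl
      exact no_tri G hg hvu h1 h5.symm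
    have e1 := hvu.ne
    have e2 := h1.ne
    have e3 := h3.ne
    have e4 := h5.ne
    have e5 := h7.ne
    refine ⟨(SimpleGraph.Walk.cons hvu (.cons h1 (.cons h3 (.cons h7.symm
      (.cons h5.symm .nil))))).toSubgraph, ⟨⟨v, _, ?_, ?_, rfl⟩, ?_⟩, ?_, ?_⟩
    · simp [SimpleGraph.Walk.isCycle_def, SimpleGraph.Walk.isTrail_def]
      grind
    · simp
    · simp
    · intro z
      simp [SimpleGraph.Subgraph.sup_adj, SimpleGraph.subgraphOfAdj_adj]
      grind
    · intro z
      simp [SimpleGraph.Subgraph.sup_adj, SimpleGraph.subgraphOfAdj_adj]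
      grind
  choose! φ hφ using ex
  rw [← Set.ncard_coe_finset]
  refine Set.ncard_le_ncard_of_injOn φ (fun p hp => (hφ p hp).1) ?_ (Set.toFinite _)
  rintro ⟨x, y⟩ hp ⟨x', y'⟩ hq heq
  obtain ⟨-, a1, a2⟩ := hφ _ hp
  obtain ⟨-, b1, b2⟩ := hφ _ hq
  have t1 := hT _ hp
  have t2 := hT _ hq
  rw [heq] at a1 a2
  simp only at *
  have hx : x = x' := by
    have := (a1 x').1 ((b1 x').2 (Or.inr rfl))
    grind
  subst hx
  have hy : y = y' := by
    have := (a2 y').1 ((b2 y').2 (Or.inr rfl))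
    grind
  subst hy
  rfl

lemma second_layer {V : Type*} [Fintype V] [DecidableEq V] (G : SimpleGraph V)
    [DecidableRel G.Adj] (d : ℕ)
    (hreg : G.IsRegularOfDegree d) (hgirth : G.egirth = 5) (v : V)
    (h5 : ∀ u : V, G.Adj v u →
      (({C : G.Subgraph | IsFiveCycle G C ∧ C.Adj v u}.ncard : ℝ)) ≤ ((d : ℝ) - 1) / 2)
    (S : Finset V) (hS : S ⊆ G.neighborFinset v) :
    ∃ f : V → V,
      (∀ u ∈ S, ∀ x, G.Adj u x → x ≠ v → G.Adj v (f x) ∧ f x ≠ u) ∧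
      (∀ u ∈ S, ∀ x y, G.Adj u x → x ≠ v → G.Adj u y → y ≠ v → f x = f y → x = y) ∧
      (∀ u ∈ S, ∀ w ∈ S, ∀ x y, G.Adj u x → x ≠ v → G.Adj w y → y ≠ v → G.Adj x y →
        f x ≠ f y) := by
  induction S using Finset.induction_on with
  | empty => exact ⟨id, by simp⟩
  | insert u S hu ih =>
    obtain ⟨f, f1, f2, f3⟩ := ih (fun x hx => hS (Finset.mem_insert_of_mem hx))
    have hvu : G.Adj v u := by simpa using hS (Finset.mem_insert_self u S)
    have hSv : ∀ w ∈ S, G.Adj v w := fun w hw => by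
      simpa using hS (Finset.mem_insert_of_mem hw)
    set X := (G.neighborFinset u).erase v with hX
    set A := (G.neighborFinset v).erase u with hA
    have cX : X.card = d - 1 := by
      rw [hX, Finset.card_erase_of_mem (by simpa using hvu.symm), G.card_neighborFinset_eq_degree,
        hreg]
    have cA : A.card = d - 1 := by
      rw [hA, Finset.card_erase_of_mem (by simpa using hvu), G.card_neighborFinset_eq_degree,
        hreg]
    let Y : V → Finset V := fun x => Finset.univ.filter
      (fun y => G.Adj x y ∧ y ≠ v ∧ ∃ w ∈ S, G.Adj w y)
    let F : V → Finset V := fun x => (Y x).image f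
    have hd : 1 ≤ d := by
      rw [← hreg v, ← G.card_neighborFinset_eq_degree]
      exact Finset.card_pos.2 ⟨u, by simpa using hvu⟩
    have hsum : 2 * ∑ x ∈ X, (F x).card ≤ A.card := by
      have h1 : ∑ x ∈ X, (F x).card ≤ ∑ x ∈ X, (Y x).card :=
        Finset.sum_le_sum fun x _ => Finset.card_image_le
      have h2 : ∑ x ∈ X, (Y x).card ≤ {C : G.Subgraph | IsFiveCycle G C ∧ C.Adj v u}.ncard := by
        have := count_aux G hgirth v u hvu
          ((X.sigma Y).map (Equiv.sigmaEquivProd V V).toEmbedding) ?_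
        · simpa [Finset.card_sigma] using this
        · rintro ⟨x, y⟩ hp
          simp only [Finset.mem_map_equiv, Finset.mem_sigma, Equiv.sigmaEquivProd_symm_apply,
            hX, Finset.mem_erase, SimpleGraph.mem_neighborFinset, Y, Finset.mem_filter,
            Finset.mem_univ, true_and] at hp
          obtain ⟨⟨p1, p2⟩, p3, p4, w, p5, p6⟩ := hp
          refine ⟨p2, p1, p3, ?_, w, hSv w p5, ?_, p6, p4⟩
          · rintro rfl
            exact no_tri G hgirth hvu p6.symm (hSv w p5).symm
          · rintro rfl
            exact hu p5
      have h3 := h5 u hvu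
      have h4 : (2 * ({C : G.Subgraph | IsFiveCycle G C ∧ C.Adj v u}.ncard : ℝ)) + 1 ≤ d := by
        linarith
      have h6 : 2 * {C : G.Subgraph | IsFiveCycle G C ∧ C.Adj v u}.ncard + 1 ≤ d := by
        exact_mod_cast h4
      omega
    obtain ⟨g, g1, g2⟩ := hall_aux X A (cX.trans cA.symm) F hsum
    have memX : ∀ x, x ∈ X ↔ G.Adj u x ∧ x ≠ v := fun x => by simp [hX, and_comm]
    have hdis : ∀ w ∈ S, ∀ x, G.Adj w x → x ≠ v → x ∉ X := by
      intro w hw x hx hxv hxX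
      have := no_four G hgirth hvu ((memX x).1 hxX).1 hx.symm (hSv w hw).symm hxv.symm
      exact hu (this ▸ hw)
    let f' : V → V := fun x => if h : x ∈ X then g ⟨x, h⟩ else f x
    have f'X : ∀ x (h : x ∈ X), f' x = g ⟨x, h⟩ := fun x h => dif_pos h
    have f'S : ∀ w ∈ S, ∀ x, G.Adj w x → x ≠ v → f' x = f x := fun w hw x hx hxv =>
      dif_neg (hdis w hw x hx hxv)
    have hcross : ∀ w ∈ S, ∀ x y, G.Adj u x → x ≠ v → G.Adj w y → y ≠ v → G.Adj x y →
        f' x ≠ f' y := by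
      intro w hw x y hx hxv hy hyv hxy he
      have hxX := (memX x).2 ⟨hx, hxv⟩
      rw [f'X x hxX, f'S w hw y hy hyv] at he
      refine (g2 ⟨x, hxX⟩).2 ?_
      rw [he]
      exact Finset.mem_image_of_mem f (by simp only [Y, Finset.mem_filter, Finset.mem_univ, true_and]; exact ⟨hxy, hyv, w, hw, hy⟩)
    refine ⟨f', ?_, ?_, ?_⟩
    · intro w hw x hx hxv
      rcases Finset.mem_insert.1 hw with rfl | hw
      · have hxX := (memX x).2 ⟨hx, hxv⟩
        rw [f'X x hxX]
        have := (g2 ⟨x, hxX⟩).1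
        simp [hA] at this
        exact this.symm
      · rw [f'S w hw x hx hxv]
        exact f1 w hw x hx hxv
    · intro w hw x y hx hxv hy hyv he
      rcases Finset.mem_insert.1 hw with rfl | hw
      · rw [f'X x ((memX x).2 ⟨hx, hxv⟩), f'X y ((memX y).2 ⟨hy, hyv⟩)] at he
        exact congrArg Subtype.val (g1 he)
      · rw [f'S w hw x hx hxv, f'S w hw y hy hyv] at he
        exact f2 w hw x y hx hxv hy hyv he
    · intro w hw w' hw' x y hx hxv hy hyv hxy
      rcases Finset.mem_insert.1 hw with rfl | hwS
      · rcases Finset.mem_insert.1 hw' with rfl | hw'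
        · exact (no_tri G hgirth hx hxy hy.symm).elim
        · exact hcross w' hw' x y hx hxv hy hyv hxy
      · rcases Finset.mem_insert.1 hw' with hw' | hw'
        · subst hw'
          exact (hcross w (by assumption) y x hy hyv hx hxv hxy.symm).symm
        · rw [f'S w hwS x hx hxv, f'S w' hw' y hy hyv]
          exact f3 w hwS w' hw' x y hx hxv hy hyv hxy

lemma greedy_extend {V K : Type*} [Fintype V] [DecidableEq V] [DecidableEq K] (G : SimpleGraph V)
    [DecidableRel G.Adj] (d : ℕ) (hreg : G.IsRegularOfDegree d) (A : Finset K)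
    (hA : d < A.card) (f : V → K) (P : Set V) (hPA : ∀ x ∈ P, f x ∈ A)
    (hP : ∀ x ∈ P, ∀ y ∈ P, G.Adj x y → f x ≠ f y) (T : Finset V) :
    ∃ g : V → K, (∀ x ∈ P, g x = f x) ∧ (∀ x, x ∈ P ∨ x ∈ T → g x ∈ A) ∧
      (∀ x y, x ∈ P ∨ x ∈ T → y ∈ P ∨ y ∈ T → G.Adj x y → g x ≠ g y) := by
  induction T using Finset.induction_on with
  | empty => exact ⟨f, by simp, by simpa using hPA, by simpa using fun x y hx hy => hP x hx y hy⟩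
  | insert t T ht ih =>
    obtain ⟨g, g1, g2, g3⟩ := ih
    by_cases htP : t ∈ P
    · refine ⟨g, g1, ?_, ?_⟩
      · intro x hx
        apply g2
        grind
      · intro x y hx hy
        apply g3 <;> grind
    · have : ((G.neighborFinset t).image g).card < A.card := by
        refine lt_of_le_of_lt Finset.card_image_le ?_
        rw [G.card_neighborFinset_eq_degree, hreg]
        exact hA
      obtain ⟨c, hcA, hc⟩ := Finset.exists_mem_notMem_of_card_lt_card this
      have hc' : ∀ y, G.Adj t y → g y ≠ c := by
        intro y hy he
        exact hc (Finset.mem_image.2 ⟨y, by simpa using hy, he⟩)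
      refine ⟨Function.update g t c, ?_, ?_, ?_⟩
      · intro x hx
        have : x ≠ t := by rintro rfl; exact htP hx
        simp [this, g1 x hx]
      · intro x hx
        by_cases hxt : x = t
        · subst hxt; simpa using hcA
        · simp only [Function.update_of_ne hxt]
          apply g2
          grind
      · intro x y hx hy hxy
        by_cases hxt : x = t
        · subst hxt
          rw [Function.update_self, Function.update_of_ne hxy.ne']
          exact (hc' y hxy).symm
        · by_cases hyt : y = t
          · subst hyt
            rw [Function.update_self, Function.update_of_ne hxt]
            exact hc' x hxy.symm
          · rw [Function.update_of_ne hxt, Function.update_of_ne hyt]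
            apply g3 <;> grind

/-- If `G` is `d`-regular with girth 5, and some vertex `v` is such that every edge at `v`
lies on at most `(d-1)/2` five-cycles, then `φ(G) = d + 1`. -/
theorem bChromatic_eq_of_few_fiveCycles_on_edges_girth_five
    {V : Type*} [Fintype V] (G : SimpleGraph V) [DecidableRel G.Adj] (d : ℕ)
    (hreg : G.IsRegularOfDegree d) (hgirth : G.egirth = 5)
    (v : V)
    (h5 : ∀ u : V, G.Adj v u →
      (({C : G.Subgraph | IsFiveCycle G C ∧ C.Adj v u}.ncard : ℝ)) ≤ ((d : ℝ) - 1) / 2) :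
    bChromaticNumber G = d + 1 := by
  classical
  apply IsGreatest.csSup_eq
  constructor
  · obtain ⟨f, f1, f2, f3⟩ := second_layer G d hreg hgirth v h5 (G.neighborFinset v) subset_rfl
    simp only [SimpleGraph.mem_neighborFinset] at f1 f2 f3
    set A := insert v (G.neighborFinset v) with hA
    have cA : A.card = d + 1 := by
      rw [hA, Finset.card_insert_of_notMem (by simp), G.card_neighborFinset_eq_degree, hreg]
    let f' : V → V := fun x => if x ∈ A then x else f x
    have memA : ∀ x, x ∈ A ↔ x = v ∨ G.Adj v x := fun x => by simp [hA]
    have nA : ∀ u x, G.Adj v u → G.Adj u x → x ≠ v → x ∉ A := by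
      intro u x hu hx hxv h
      rcases (memA x).1 h with h | h
      · exact hxv h
      · exact no_tri G hgirth hu hx h.symm
    obtain ⟨g, g1, g2, g3⟩ := greedy_extend G d hreg A (by omega) f'
      {x | x ∈ A ∨ ∃ u, G.Adj v u ∧ G.Adj u x ∧ x ≠ v} (by
        rintro x (hx | ⟨u, hu, hx, hxv⟩)
        · simp only [f', if_pos hx]; exact hx
        · simp only [f', if_neg (nA u x hu hx hxv)]
          exact (memA _).2 (Or.inr (f1 u hu x hx hxv).1))
      (by
        have key : ∀ x ∈ A, ∀ y, (∃ u, G.Adj v u ∧ G.Adj u y ∧ y ≠ v) → G.Adj x y →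
            x ≠ f y := by
          rintro x hx y ⟨u, hu, hy, hyv⟩ hxy he
          have h1 := f1 u hu y hy hyv
          rcases (memA x).1 hx with rfl | hx
          · rw [← he] at h1
            exact h1.1.ne rfl
          · have := no_four G hgirth hu hy hxy.symm hx.symm hyv.symm
            exact h1.2 (he ▸ this.symm)
        rintro x (hx | ⟨u, hu, hx, hxv⟩) y (hy | ⟨w, hw, hy, hyv⟩) hxy
        · simp only [f', if_pos hx, if_pos hy]; exact hxy.ne
        · simp only [f', if_pos hx, if_neg (nA w y hw hy hyv)]
          exact key x hx y ⟨w, hw, hy, hyv⟩ hxy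
        · simp only [f', if_pos hy, if_neg (nA u x hu hx hxv)]
          exact (key y hy x ⟨u, hu, hx, hxv⟩ hxy.symm).symm
        · simp only [f', if_neg (nA u x hu hx hxv), if_neg (nA w y hw hy hyv)]
          exact f3 u hu w hw x y hx hxv hy hyv hxy)
      Finset.univ
    simp only [Finset.mem_univ, or_true, forall_const] at g2 g3
    have gA : ∀ k ∈ A, g k = k := fun k hk => by
      rw [g1 k (Or.inl hk)]; simp only [f', if_pos hk]
    have dom : ∀ k ∈ A, ∀ k' ∈ A, k' ≠ k → ∃ w, G.Adj k w ∧ g w = k' := by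
      intro k hk k' hk' hne
      rcases (memA k).1 hk with rfl | hkv
      · exact ⟨k', ((memA k').1 hk').resolve_left hne, gA k' hk'⟩
      · rcases (memA k').1 hk' with rfl | hkv'
        · exact ⟨k', hkv.symm, gA k' hk'⟩
        · have := Finset.surj_on_of_inj_on_of_card_le
            (s := (G.neighborFinset k).erase v) (t := (G.neighborFinset v).erase k)
            (fun x _ => f x)
            (by
              intro x hx
              simp only [Finset.mem_erase, SimpleGraph.mem_neighborFinset] at hx ⊢
              exact (f1 k hkv x hx.2 hx.1).symm)
            (by
              intro x y hx hy he
              simp only [Finset.mem_erase, SimpleGraph.mem_neighborFinset] at hx hy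
              exact f2 k hkv x y hx.2 hx.1 hy.2 hy.1 he)
            (by
              rw [Finset.card_erase_of_mem (by simpa using hkv),
                Finset.card_erase_of_mem (by simpa using hkv.symm),
                G.card_neighborFinset_eq_degree, G.card_neighborFinset_eq_degree, hreg, hreg])
            k' (by simp [hne, hkv'])
          obtain ⟨x, hx, he⟩ := this
          simp only [Finset.mem_erase, SimpleGraph.mem_neighborFinset] at hx
          refine ⟨x, hx.2, ?_⟩
          rw [g1 x (Or.inr ⟨k, hkv, hx.2, hx.1⟩)]
          simp only [f', if_neg (nA k x hkv hx.2 hx.1)]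
          exact he.symm
    let e : A ≃ Fin (d + 1) := A.equivFinOfCardEq cA
    refine ⟨fun x => e ⟨g x, g2 x⟩, ?_, ?_⟩
    · intro x y hxy he
      exact g3 x y hxy (congrArg Subtype.val (e.injective he))
    · intro c
      obtain ⟨⟨k, hk⟩, rfl⟩ := e.surjective c
      refine ⟨k, by simp [gA k hk], ?_⟩
      intro c' hc'
      obtain ⟨⟨k', hk'⟩, rfl⟩ := e.surjective c'
      obtain ⟨w, hw, hw'⟩ := dom k hk k' hk' (by rintro rfl; exact hc' rfl)
      exact ⟨w, hw, by simp [hw']⟩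
  · rintro k ⟨C, -, hC⟩
    by_contra hk
    push Not at hk
    obtain ⟨x, hx, hx'⟩ := hC ⟨0, by omega⟩
    have hsub : (Finset.univ.erase (⟨0, by omega⟩ : Fin k)) ⊆ (G.neighborFinset x).image C := by
      intro c hc
      obtain ⟨u, hu, hu'⟩ := hx' c (Finset.ne_of_mem_erase hc)
      exact Finset.mem_image.2 ⟨u, by simpa using hu, hu'⟩
    have h1 := (Finset.card_le_card hsub).trans Finset.card_image_le
    rw [Finset.card_erase_of_mem (Finset.mem_univ _), G.card_neighborFinset_eq_degree, hreg,
      Finset.card_univ, Fintype.card_fin] at h1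
    omega
end

section
/- Let G be a d-regular simple graph of girth 5. For an edge {u, v} of G, let max_{u,v} denote the maximum number of 5-cycles of G such that the intersection of any two different ones of them is exactly the edge {u, v}; for a path P of length two in G, let max_P denote the maximum number of 5-cycles of G such that the intersection of any two different ones of them is exactly the path P. If there exists a vertex v of G such that for every edge {u, v} incident with v one has max_{u,v} ≤ (d-1)/2, and for every path P of length two one has max_P ≤ (d-1)/2, then φ(G) = d + 1. -/
open SimpleGraph

/-- `P` is a path of length two of `G`, represented as the subgraph of a path walk of length 2. -/
def IsTwoPath {V : Type*} (G : SimpleGraph V) (P : G.Subgraph) : Prop :=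
  ∃ (a b : V) (w : G.Walk a b), w.IsPath ∧ w.length = 2 ∧ P = w.toSubgraph

/-- The maximum number of 5-cycles of `G` such that the intersection of any two different
ones of them is exactly the subgraph `P`. -/
noncomputable def maxFiveCyclesInter {V : Type*} (G : SimpleGraph V) (P : G.Subgraph) : ℕ :=
  sSup {n : ℕ | ∃ S : Set G.Subgraph, S.ncard = n ∧ (∀ C ∈ S, IsFiveCycle G C) ∧
    ∀ C₁ ∈ S, ∀ C₂ ∈ S, C₁ ≠ C₂ → C₁ ⊓ C₂ = P}

open Classical in
theorem aux_le_max {V : Type*} [Fintype V] (G : SimpleGraph V) (P : G.Subgraph)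
    (S : Set G.Subgraph) (h1 : ∀ C ∈ S, IsFiveCycle G C)
    (h2 : ∀ C₁ ∈ S, ∀ C₂ ∈ S, C₁ ≠ C₂ → C₁ ⊓ C₂ = P) :
    S.ncard ≤ maxFiveCyclesInter G P := by
  refine le_csSup ⟨Nat.card G.Subgraph, ?_⟩ ⟨S, rfl, h1, h2⟩
  rintro n ⟨T, rfl, -, -⟩
  exact Set.ncard_le_card T

theorem aux_cycle {V : Type*} (G : SimpleGraph V) {a b c d e : V}
    (hab : G.Adj a b) (hbc : G.Adj b c) (hcd : G.Adj c d) (hde : G.Adj d e) (hea : G.Adj e a)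
    (h1 : a ≠ c) (h2 : a ≠ d) (h3 : b ≠ d) (h4 : b ≠ e) (h5 : c ≠ e) :
    ∃ C : G.Subgraph, IsFiveCycle G C ∧ C.verts = {a, b, c, d, e} ∧ C.Adj a b ∧ C.Adj b c := by
  let w : G.Walk a a := .cons hab (.cons hbc (.cons hcd (.cons hde (.cons hea .nil))))
  refine ⟨w.toSubgraph, ⟨a, w, ?_, rfl, rfl⟩, ?_, ?_, ?_⟩
  · have := hab.ne; have := hbc.ne; have := hcd.ne; have := hde.ne; have := hea.ne
    simp only [w, SimpleGraph.Walk.cons_isCycle_iff, SimpleGraph.Walk.cons_isPath_iff,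
      SimpleGraph.Walk.support_cons, SimpleGraph.Walk.support_nil, SimpleGraph.Walk.edges_cons,
      SimpleGraph.Walk.edges_nil, List.mem_cons, List.not_mem_nil, Sym2.eq_iff,
      SimpleGraph.Walk.IsPath.nil]
    grind
  · ext z
    simp [w]
    grind
  · simp [w]
  · simp [w]

theorem aux_inf {V : Type*} (G : SimpleGraph V) (P C D : G.Subgraph)
    (hC : P ≤ C) (hD : P ≤ D) (hv : C.verts ∩ D.verts ⊆ P.verts)
    (hind : ∀ a ∈ P.verts, ∀ b ∈ P.verts, G.Adj a b → P.Adj a b) : C ⊓ D = P := by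
  apply le_antisymm _ (le_inf hC hD)
  refine ⟨hv, ?_⟩
  intro a b hab
  have h : C.Adj a b ∧ D.Adj a b := hab
  exact hind a (hv ⟨h.1.fst_mem, h.2.fst_mem⟩) b (hv ⟨h.1.snd_mem, h.2.snd_mem⟩) h.1.adj_sub

theorem aux_family {V ι : Type*} [Fintype V] (G : SimpleGraph V) (P : G.Subgraph)
    (Y : Finset ι) (F : ι → G.Subgraph) (hF : ∀ y ∈ Y, IsFiveCycle G (F y))
    (hP : ∀ y ∈ Y, P ≤ F y) (hne : ∀ y ∈ Y, ¬ (F y).verts ⊆ P.verts)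
    (hv : ∀ y ∈ Y, ∀ z ∈ Y, y ≠ z → (F y).verts ∩ (F z).verts ⊆ P.verts)
    (hind : ∀ a ∈ P.verts, ∀ b ∈ P.verts, G.Adj a b → P.Adj a b) :
    Y.card ≤ maxFiveCyclesInter G P := by
  have hinj : Set.InjOn F (Y : Set ι) := by
    intro y hy z hz h
    by_contra hn
    apply hne y hy
    have := hv y hy z hz hn
    rw [← h, Set.inter_self] at this
    exact this
  have := aux_le_max G P (F '' (Y : Set ι)) (by rintro _ ⟨y, hy, rfl⟩; exact hF y hy) (by
    rintro _ ⟨y, hy, rfl⟩ _ ⟨z, hz, rfl⟩ h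
    exact aux_inf G P _ _ (hP y hy) (hP z hz) (hv y hy z hz (fun h' => h (by rw [h']))) hind)
  rwa [hinj.ncard_image, Set.ncard_coe_finset] at this

theorem aux_tri {V : Type*} (G : SimpleGraph V) (hg : G.egirth = 5) {a b c : V}
    (hab : G.Adj a b) (hbc : G.Adj b c) (hca : G.Adj c a) : False := by
  have hc : (SimpleGraph.Walk.cons hab (.cons hbc (.cons hca .nil))).IsCycle := by
    have := hab.ne; have := hbc.ne; have := hca.ne
    simp only [SimpleGraph.Walk.cons_isCycle_iff, SimpleGraph.Walk.cons_isPath_iff,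
      SimpleGraph.Walk.support_cons, SimpleGraph.Walk.support_nil, SimpleGraph.Walk.edges_cons,
      SimpleGraph.Walk.edges_nil, List.mem_cons, List.not_mem_nil, Sym2.eq_iff,
      SimpleGraph.Walk.IsPath.nil]
    grind
  have h := SimpleGraph.le_egirth.1 hg.ge a _ hc
  simp at h
  exact absurd h (by decide)

theorem aux_quad {V : Type*} (G : SimpleGraph V) (hg : G.egirth = 5) {a b c d : V}
    (hab : G.Adj a b) (hbc : G.Adj b c) (hcd : G.Adj c d) (hda : G.Adj d a) (hac : a ≠ c) :
    b = d := by
  by_contra hbd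
  have hc : (SimpleGraph.Walk.cons hab (.cons hbc (.cons hcd (.cons hda .nil)))).IsCycle := by
    have := hab.ne; have := hbc.ne; have := hcd.ne; have := hda.ne
    simp only [SimpleGraph.Walk.cons_isCycle_iff, SimpleGraph.Walk.cons_isPath_iff,
      SimpleGraph.Walk.support_cons, SimpleGraph.Walk.support_nil, SimpleGraph.Walk.edges_cons,
      SimpleGraph.Walk.edges_nil, List.mem_cons, List.not_mem_nil, Sym2.eq_iff,
      SimpleGraph.Walk.IsPath.nil]
    grind
  have h := SimpleGraph.le_egirth.1 hg.ge a _ hc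
  simp at h
  exact absurd h (by decide)

/-- Number of second-neighbourhood neighbours of `x`. -/
theorem aux_path_bound {V : Type*} [Fintype V] (G : SimpleGraph V) (hg : G.egirth = 5) (m : ℝ)
    (hpath : ∀ P : G.Subgraph, IsTwoPath G P → ((maxFiveCyclesInter G P : ℝ)) ≤ m)
    {v u x : V} (hvu : G.Adj v u) (hux : G.Adj u x) (hxv : x ≠ v) (Y : Finset V)
    (hY : ∀ y ∈ Y, G.Adj x y ∧ y ≠ u ∧ ∃ w, G.Adj v w ∧ G.Adj w y) : (Y.card : ℝ) ≤ m := by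
  let p : G.Walk v x := .cons hvu (.cons hux .nil)
  have hp : p.IsPath := by
    have := hvu.ne; have := hux.ne
    simp [p]
    grind
  have hxv' : ¬ G.Adj x v := fun h => aux_tri G hg hvu hux h
  have key : ∀ y ∈ Y, ∃ w, ∃ C : G.Subgraph, G.Adj v w ∧ G.Adj w y ∧ IsFiveCycle G C ∧
      C.verts = {v, u, x, y, w} ∧ C.Adj v u ∧ C.Adj u x := by
    intro y hy
    obtain ⟨h1, h2, w, h3, h4⟩ := hY y hy
    obtain ⟨C, hC⟩ := aux_cycle G hvu hux h1 h4.symm h3.symm hxv.symm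
      (by rintro rfl; exact hxv' h1) h2.symm (by rintro rfl; exact aux_tri G hg hux h1 h4.symm)
      (by rintro rfl; exact hxv' h3.symm)
    exact ⟨w, C, h3, h4, hC⟩
  choose! W F hW1 hW2 hF hFv hF1 hF2 using key
  have hyv : ∀ y ∈ Y, ¬ G.Adj y v := fun y hy h =>
    (hY y hy).2.1 (aux_quad G hg hvu hux (hY y hy).1 h hxv.symm).symm
  have hPv : p.toSubgraph.verts = {v, u, x} := by
    ext z; simp [p]; tauto
  refine le_trans ?_ (hpath p.toSubgraph ⟨v, x, p, hp, rfl, rfl⟩)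
  refine Nat.cast_le.2 (aux_family G p.toSubgraph Y F hF ?_ ?_ ?_ ?_)
  · intro y hy
    constructor
    · rw [hPv, hFv y hy]; intro z; simp; grind
    · intro a b hab
      have h1 := hF1 y hy
      have h2 := hF2 y hy
      have h1' := h1.symm
      have h2' := h2.symm
      simp [p] at hab
      grind
  · intro y hy h
    rw [hPv, hFv y hy] at h
    have h1 := @h y (by simp)
    have := hY y hy
    have := hyv y hy
    have := this
    simp at h1
    rcases h1 with rfl | rfl | rfl
    · exact hxv' (hY _ hy).1
    · exact (hY _ hy).2.1 rfl
    · exact (hY _ hy).1.ne rfl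
  · intro y hy z hz hyz a ha
    rw [hFv y hy, hFv z hz] at ha
    rw [hPv]
    have e1 : W y ≠ W z := fun h => hyz
      (aux_quad G hg (hY y hy).1 (hW2 y hy).symm (by rw [h]; exact hW2 z hz) (hY z hz).1.symm
        (by rintro h'; exact hxv' (h' ▸ (hW1 y hy).symm)))
    have e2 : y ≠ W z := fun h => hyv y hy (h ▸ (hW1 z hz).symm)
    have e3 : z ≠ W y := fun h => hyv z hz (h ▸ (hW1 y hy).symm)
    simp at ha ⊢
    grind
  · rw [hPv]
    have hxv'' : ¬ G.Adj v x := fun h => hxv' h.symm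
    intro a ha b hb hab
    have := hab.ne
    simp [p] at ha hb ⊢
    grind

theorem aux_edge_bound {V : Type*} [Fintype V] (G : SimpleGraph V) (hg : G.egirth = 5) (m : ℝ)
    {v u : V} (hvu : G.Adj v u)
    (hedge : ((maxFiveCyclesInter G (G.subgraphOfAdj hvu) : ℝ)) ≤ m)
    (X : Finset V) (y w : V → V)
    (hX : ∀ x ∈ X, G.Adj u x ∧ x ≠ v ∧ G.Adj x (y x) ∧ y x ≠ u ∧ G.Adj (y x) (w x) ∧
      G.Adj (w x) v)
    (hw : ∀ x ∈ X, ∀ x' ∈ X, w x = w x' → x = x') : (X.card : ℝ) ≤ m := by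
  have hxv' : ∀ x ∈ X, ¬ G.Adj x v := fun x hx h => aux_tri G hg hvu (hX x hx).1 h
  have hyv : ∀ x ∈ X, ¬ G.Adj (y x) v := fun x hx h => by
    obtain ⟨h1, h2, h3, h4, h5, h6⟩ := hX x hx
    exact h4 (aux_quad G hg hvu h1 h3 h h2.symm).symm
  have hyu : ∀ x ∈ X, ¬ G.Adj u (y x) := fun x hx h => by
    obtain ⟨h1, h2, h3, h4, h5, h6⟩ := hX x hx
    exact aux_tri G hg h1 h3 h.symm
  have key : ∀ x ∈ X, ∃ C : G.Subgraph, IsFiveCycle G C ∧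
      C.verts = {v, u, x, y x, w x} ∧ C.Adj v u := by
    intro x hx
    obtain ⟨h1, h2, h3, h4, h5, h6⟩ := hX x hx
    obtain ⟨C, hC1, hC2, hC3, -⟩ := aux_cycle G hvu h1 h3 h5 h6 h2.symm
      (fun h => hxv' x hx (by rw [h]; exact h3)) h4.symm
      (fun h => hyu x hx (by rw [h]; exact h5.symm)) (fun h => hxv' x hx (by rw [h]; exact h6))
    exact ⟨C, hC1, hC2, hC3⟩
  choose! F hF hFv hF1 using key
  refine le_trans (Nat.cast_le.2 (aux_family G (G.subgraphOfAdj hvu) X F hF ?_ ?_ ?_ ?_)) hedge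
  · intro x hx
    exact SimpleGraph.subgraphOfAdj_le_of_adj _ (hF1 x hx)
  · intro x hx h
    rw [hFv x hx] at h
    have h1 := @h x (by simp)
    simp at h1
    rcases h1 with rfl | rfl
    · exact (hX _ hx).2.1 rfl
    · exact (hX _ hx).1.ne rfl
  · intro x hx z hz hxz a ha
    rw [hFv x hx, hFv z hz] at ha
    have e1 : w x ≠ w z := fun h => hxz (hw x hx z hz h)
    have e2 : y x ≠ y z := fun h => hxz (by
      obtain ⟨h1, h2, h3, h4, h5, h6⟩ := hX x hx
      obtain ⟨k1, k2, k3, k4, k5, k6⟩ := hX z hz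
      exact aux_quad G hg h1 h3 (by rw [h]; exact k3.symm) k1.symm h4.symm)
    have e3 : x ≠ w z := fun h => hxv' x hx (by rw [h]; exact (hX z hz).2.2.2.2.2)
    have e4 : z ≠ w x := fun h => hxv' z hz (by rw [h]; exact (hX x hx).2.2.2.2.2)
    have e5 : y x ≠ w z := fun h => hyv x hx (by rw [h]; exact (hX z hz).2.2.2.2.2)
    have e6 : y z ≠ w x := fun h => hyv z hz (by rw [h]; exact (hX x hx).2.2.2.2.2)
    have e7 : x ≠ y z := fun h => hyu z hz (by rw [← h]; exact (hX x hx).1)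
    have e8 : z ≠ y x := fun h => hyu x hx (by rw [← h]; exact (hX z hz).1)
    simp at ha ⊢
    grind
  · intro a ha b hb hab
    have := hab.ne
    simp at ha hb ⊢
    grind

open Classical in
/-- Colouring of the second neighbourhood, one block at a time. -/
theorem aux_blocks {V : Type*} [Fintype V] (G : SimpleGraph V) (d : ℕ)
    (hreg : ∀ x, (G.neighborFinset x).card = d) (hg : G.egirth = 5) (v : V)
    (hedge : ∀ u : V, ∀ h : G.Adj v u,
      ((maxFiveCyclesInter G (G.subgraphOfAdj h) : ℝ)) ≤ ((d : ℝ) - 1) / 2)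
    (hpath : ∀ P : G.Subgraph, IsTwoPath G P →
      ((maxFiveCyclesInter G P : ℝ)) ≤ ((d : ℝ) - 1) / 2)
    (I : Finset V) (hI : I ⊆ G.neighborFinset v) :
    ∃ f : V → V, (∀ u ∈ I, ∀ x, G.Adj u x → x ≠ v → G.Adj v (f x) ∧ f x ≠ u) ∧
      (∀ u ∈ I, ∀ x, G.Adj u x → x ≠ v → ∀ y, G.Adj u y → y ≠ v → f x = f y → x = y) ∧
      (∀ u ∈ I, ∀ x, G.Adj u x → x ≠ v → ∀ u' ∈ I, ∀ y, G.Adj u' y → y ≠ v → G.Adj x y →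
        f x ≠ f y) := by
  induction I using Finset.induction_on with
  | empty => exact ⟨id, by simp, by simp, by simp⟩
  | insert u I hu ih =>
    obtain ⟨f, f1, f2, f3⟩ := ih (fun z hz => hI (Finset.mem_insert_of_mem hz))
    have hvu : G.Adj v u := by simpa using hI (Finset.mem_insert_self u I)
    have hvI : ∀ w ∈ I, G.Adj v w := fun w hw => by simpa using hI (Finset.mem_insert_of_mem hw)
    -- neighbours of x which are already coloured
    let B : V → Finset V := fun x =>
      (G.neighborFinset x).filter (fun y => y ≠ v ∧ ∃ w ∈ I, G.Adj w y)
    have hBu : ∀ x, ∀ y ∈ B x, y ≠ u := by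
      intro x y hy
      simp only [B, Finset.mem_filter] at hy
      obtain ⟨-, h1, w, hw, h2⟩ := hy
      rintro rfl
      exact aux_tri G hg hvu h2.symm (hvI w hw).symm
    let K : Finset V := (G.neighborFinset v).erase u
    have hK : K.card + 1 = d := by
      rw [Finset.card_erase_add_one (by simpa using hvu), hreg]
    have hKr : (K.card : ℝ) = d - 1 := by rw [← hK]; push_cast; ring
    let t : {x // G.Adj u x ∧ x ≠ v} → Finset V := fun x => K \ (B x).image f
    have hall : ∀ S : Finset {x // G.Adj u x ∧ x ≠ v}, S.card ≤ (S.biUnion t).card := by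
      intro S
      rcases S.eq_empty_or_nonempty with rfl | ⟨x, hx⟩
      · simp
      have hSK : S.card ≤ K.card := by
        have h1 : (S.map (Function.Embedding.subtype _)) ⊆ (G.neighborFinset u).erase v := by
          intro z hz
          simp at hz ⊢
          tauto
        have h2 := Finset.card_le_card h1
        have h3 : ((G.neighborFinset u).erase v).card + 1 = d := by
          rw [Finset.card_erase_add_one (by simpa using hvu.symm), hreg]
        rw [Finset.card_map] at h2
        omega
      by_cases hfull : K ⊆ S.biUnion t
      · exact hSK.trans (Finset.card_le_card hfull)
      · obtain ⟨c, hcK, hc⟩ := Finset.not_subset.1 hfull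
        have hSle : (S.card : ℝ) ≤ (d - 1) / 2 := by
          have h1 : ∀ z : V, z ∈ S.map (Function.Embedding.subtype _) → ∃ y w, y ∈ B z ∧ f y = c ∧
              w ∈ I ∧ G.Adj w y := by
            intro z hz
            simp only [Finset.mem_map, Function.Embedding.subtype_apply] at hz
            obtain ⟨z', hz', rfl⟩ := hz
            have : c ∉ t z' := fun h => hc (Finset.mem_biUnion.2 ⟨z', hz', h⟩)
            simp only [t, Finset.mem_sdiff, hcK, true_and, not_not, Finset.mem_image] at this
            obtain ⟨y, hy, hyc⟩ := this
            have hy' := hy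
            simp only [B, Finset.mem_filter] at hy'
            obtain ⟨-, -, w, hw, hwy⟩ := hy'
            exact ⟨y, w, hy, hyc, hw, hwy⟩
          choose! Y W g1 g2 g3 g4 using h1
          have hmem : ∀ z ∈ S.map (Function.Embedding.subtype _), G.Adj u z ∧ z ≠ v := by
            intro z hz
            simp at hz
            tauto
          have hY : ∀ z ∈ S.map (Function.Embedding.subtype _), G.Adj z (Y z) ∧ Y z ≠ v := by
            intro z hz
            have := g1 z hz
            simp only [B, Finset.mem_filter, SimpleGraph.mem_neighborFinset] at this
            tauto
          have := aux_edge_bound G hg _ hvu (hedge u hvu) (S.map (Function.Embedding.subtype _)) Y W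
            (by
              intro z hz
              exact ⟨(hmem z hz).1, (hmem z hz).2, (hY z hz).1, hBu _ _ (g1 z hz), (g4 z hz).symm,
                (hvI _ (g3 z hz)).symm⟩)
            (by
              intro z hz z' hz' hW
              have hYY : Y z = Y z' := f2 (W z) (g3 z hz) _ (g4 z hz) (hY z hz).2 _
                (by rw [hW]; exact g4 z' hz') (hY z' hz').2 (by rw [g2 z hz, g2 z' hz'])
              exact aux_quad G hg (hmem z hz).1 (hY z hz).1 (by rw [hYY]; exact (hY z' hz').1.symm)
                (hmem z' hz').1.symm (hBu _ _ (g1 z hz)).symm)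
          rwa [Finset.card_map] at this
        have hB : ((B x).card : ℝ) ≤ (d - 1) / 2 := by
          refine aux_path_bound G hg _ hpath hvu x.2.1 x.2.2 (B x) ?_
          intro y hy
          have := hBu _ _ hy
          simp only [B, Finset.mem_filter, SimpleGraph.mem_neighborFinset] at hy
          obtain ⟨h1, h2, w, hw, h3⟩ := hy
          exact ⟨h1, this, w, hvI w hw, h3⟩
        have h5 : (t x).card ≤ (S.biUnion t).card :=
          Finset.card_le_card (Finset.subset_biUnion_of_mem t hx)
        have h6 : K.card ≤ (t x).card + (B x).card := by
          have h7 : K.card - ((B x).image f).card ≤ (t x).card := Finset.le_card_sdiff _ _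
          have h8 : ((B x).image f).card ≤ (B x).card := Finset.card_image_le
          omega
        have h6' : (K.card : ℝ) ≤ (t x).card + (B x).card := by exact_mod_cast h6
        have h9 : (S.card : ℝ) ≤ (t x).card := by linarith
        exact (by exact_mod_cast h9 : S.card ≤ (t x).card).trans h5
    obtain ⟨g, ginj, hgt⟩ := (Finset.all_card_le_biUnion_card_iff_exists_injective t).1 hall
    have gt : ∀ x, (G.Adj v (g x) ∧ g x ≠ u) ∧ ∀ y, G.Adj x y → y ≠ v → ∀ w ∈ I, G.Adj w y →
        g x ≠ f y := by
      intro x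
      have h := hgt x
      simp only [t, K, B, Finset.mem_sdiff, Finset.mem_erase, Finset.mem_image, Finset.mem_filter,
        SimpleGraph.mem_neighborFinset] at h
      refine ⟨⟨h.1.2, h.1.1⟩, fun y h1 h2 w h3 h4 h5 => h.2 ⟨y, ⟨h1, h2, w, h3, h4⟩, h5.symm⟩⟩
    let F : V → V := fun x => if h : G.Adj u x ∧ x ≠ v then g ⟨x, h⟩ else f x
    have Fu : ∀ x (h : G.Adj u x ∧ x ≠ v), F x = g ⟨x, h⟩ := fun x h => by simp [F, h]
    have FI : ∀ w ∈ I, ∀ x, G.Adj w x → x ≠ v → F x = f x := by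
      intro w hw x h1 h2
      have : ¬ G.Adj u x := fun h3 => hu (by
        rw [← aux_quad G hg (hvI w hw) h1 h3.symm hvu.symm h2.symm]; exact hw)
      simp [F, this]
    refine ⟨F, ?_, ?_, ?_⟩
    · intro w hw x h1 h2
      rcases Finset.mem_insert.1 hw with rfl | hw
      · rw [Fu x ⟨h1, h2⟩]; exact (gt _).1
      · rw [FI w hw x h1 h2]; exact f1 w hw x h1 h2
    · intro w hw x h1 h2 y h3 h4
      rcases Finset.mem_insert.1 hw with rfl | hw
      · rw [Fu x ⟨h1, h2⟩, Fu y ⟨h3, h4⟩]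
        intro h
        exact congrArg Subtype.val (ginj h)
      · rw [FI w hw x h1 h2, FI w hw y h3 h4]; exact f2 w hw x h1 h2 y h3 h4
    · intro w hw x h1 h2 w' hw' y h3 h4 hxy
      rcases Finset.mem_insert.1 hw with rfl | hwI <;> rcases Finset.mem_insert.1 hw' with rfl | hwI'
      · exact (aux_tri G hg h1 hxy h3.symm).elim
      · rw [Fu x ⟨h1, h2⟩, FI w' hwI' y h3 h4]
        exact (gt _).2 y hxy h4 w' hwI' h3
      · rw [Fu y ⟨h3, h4⟩, FI w hwI x h1 h2]
        exact ((gt ⟨y, h3, h4⟩).2 x hxy.symm h2 w hwI h1).symm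
      · rw [FI w hwI x h1 h2, FI w' hwI' y h3 h4]
        exact f3 w hwI x h1 h2 w' hwI' y h3 h4 hxy

open Classical in
theorem aux_extend {V : Type*} [Fintype V] (G : SimpleGraph V) (d : ℕ)
    (hreg : ∀ x, (G.neighborFinset x).card = d) (K : Finset V) (hK : d < K.card)
    (D : Finset V) (f : V → V) (hfK : ∀ x ∈ D, f x ∈ K)
    (hf : ∀ x ∈ D, ∀ y ∈ D, G.Adj x y → f x ≠ f y) (T : Finset V) :
    ∃ g : V → V, (∀ x ∈ D, g x = f x) ∧ (∀ x ∈ D ∪ T, g x ∈ K) ∧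
      ∀ x ∈ D ∪ T, ∀ y ∈ D ∪ T, G.Adj x y → g x ≠ g y := by
  induction T using Finset.induction_on with
  | empty => exact ⟨f, by simp, by simpa using hfK, by simpa using hf⟩
  | insert a T ha ih =>
    obtain ⟨g, g1, g2, g3⟩ := ih
    by_cases haD : a ∈ D
    · have : D ∪ insert a T = D ∪ T := by ext z; simp; grind
      rw [this]; exact ⟨g, g1, g2, g3⟩
    · obtain ⟨c, hcK, hc⟩ : ∃ c ∈ K, c ∉ (G.neighborFinset a).image g := by
        by_contra! h
        have h1 := Finset.card_le_card (show K ⊆ (G.neighborFinset a).image g from h)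
        have h2 : ((G.neighborFinset a).image g).card ≤ _ := Finset.card_image_le
        rw [hreg] at h2
        omega
      have hc' : ∀ y, G.Adj a y → g y ≠ c := fun y hy h => hc (by
        simp only [Finset.mem_image, SimpleGraph.mem_neighborFinset]; exact ⟨y, hy, h⟩)
      refine ⟨Function.update g a c, ?_, ?_, ?_⟩
      · intro x hx
        rw [Function.update_of_ne (by rintro rfl; exact haD hx), g1 x hx]
      · intro x hx
        by_cases h : x = a
        · subst h; simpa using hcK
        · rw [Function.update_of_ne h]; exact g2 x (by simp at hx ⊢; tauto)
      · intro x hx y hy hxy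
        by_cases h : x = a
        · subst h
          rw [Function.update_self, Function.update_of_ne hxy.ne']
          exact (hc' y hxy).symm
        · by_cases h' : y = a
          · subst h'
            rw [Function.update_self, Function.update_of_ne h]
            exact hc' x hxy.symm
          · rw [Function.update_of_ne h, Function.update_of_ne h']
            exact g3 x (by simp at hx ⊢; tauto) y (by simp at hy ⊢; tauto) hxy

theorem aux_upper {V : Type*} [Fintype V] (G : SimpleGraph V) [DecidableRel G.Adj] (d k : ℕ)
    (hreg : G.IsRegularOfDegree d) (C : V → Fin k) (hC : IsBColoring G k C) : k ≤ d + 1 := by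
  classical
  rcases k with _ | k
  · omega
  obtain ⟨v, hv, h⟩ := hC.2 0
  have h1 : (Finset.univ.erase (0 : Fin (k + 1))) ⊆ (G.neighborFinset v).image C := by
    intro c hc
    obtain ⟨u, hu, huc⟩ := h c (by simpa using hc)
    simp only [Finset.mem_image, SimpleGraph.mem_neighborFinset]
    exact ⟨u, hu, huc⟩
  have h2 := Finset.card_le_card h1
  have h3 : ((G.neighborFinset v).image C).card ≤ _ := Finset.card_image_le
  rw [G.card_neighborFinset_eq_degree, hreg v] at h3
  simp at h2
  omega

open Classical in
theorem aux_lower {V : Type*} [Fintype V] (G : SimpleGraph V) (d : ℕ)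
    (hreg : ∀ x, (G.neighborFinset x).card = d) (hg : G.egirth = 5) (v : V)
    (hedge : ∀ u : V, ∀ h : G.Adj v u,
      ((maxFiveCyclesInter G (G.subgraphOfAdj h) : ℝ)) ≤ ((d : ℝ) - 1) / 2)
    (hpath : ∀ P : G.Subgraph, IsTwoPath G P →
      ((maxFiveCyclesInter G P : ℝ)) ≤ ((d : ℝ) - 1) / 2) :
    ∃ C : V → Fin (d + 1), IsBColoring G (d + 1) C := by
  obtain ⟨f, f1, f2, f3⟩ := aux_blocks G d hreg hg v hedge hpath (G.neighborFinset v) subset_rfl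
  simp only [SimpleGraph.mem_neighborFinset] at f1 f2 f3
  let K : Finset V := insert v (G.neighborFinset v)
  have hK : K.card = d + 1 := by rw [Finset.card_insert_of_notMem (by simp), hreg]
  have hKm : ∀ x, x ∈ K ↔ x = v ∨ G.Adj v x := fun x => by simp [K]
  let F : V → V := fun x => if x = v ∨ G.Adj v x then x else f x
  let D : Finset V := Finset.univ.filter (fun x => x = v ∨ G.Adj v x ∨ ∃ u, G.Adj v u ∧ G.Adj u x)
  have hF1 : ∀ x, x = v ∨ G.Adj v x → F x = x := fun x h => by simp only [F, if_pos h]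
  have hF2 : ∀ u, G.Adj v u → ∀ x, G.Adj u x → x ≠ v → F x = f x := by
    intro u hu x hx hxv
    have : ¬ (x = v ∨ G.Adj v x) := by
      rintro (h | h)
      · exact hxv h
      · exact aux_tri G hg hu hx h.symm
    simp only [F, if_neg this]
  -- the three kinds of vertices
  have hD : ∀ x ∈ D, x = v ∨ G.Adj v x ∨ ∃ u, G.Adj v u ∧ G.Adj u x ∧ x ≠ v := by
    intro x hx
    simp only [D, Finset.mem_filter, Finset.mem_univ, true_and] at hx
    by_cases h : x = v
    · exact Or.inl h
    · rcases hx with h' | h' | ⟨u, h1, h2⟩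
      · exact Or.inl h'
      · exact Or.inr (Or.inl h')
      · exact Or.inr (Or.inr ⟨u, h1, h2, h⟩)
  have hmix : ∀ x, (x = v ∨ G.Adj v x) → ∀ u y, G.Adj v u → G.Adj u y → y ≠ v → G.Adj x y →
      x ≠ f y := by
    intro x hx u y h1 h2 h3 hxy he
    rcases hx with rfl | hx
    · exact aux_tri G hg h1 h2 hxy.symm
    · have : x = u := aux_quad G hg hx hxy h2.symm h1.symm h3.symm
      subst this
      exact (f1 x h1 y h2 h3).2 he.symm
  obtain ⟨g, g1, g2, g3⟩ := aux_extend G d hreg K (by omega) D F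
    (by
      intro x hx
      rcases hD x hx with h | h | ⟨u, h1, h2, h3⟩
      · rw [hF1 x (Or.inl h), hKm]; exact Or.inl h
      · rw [hF1 x (Or.inr h), hKm]; exact Or.inr h
      · rw [hF2 u h1 x h2 h3, hKm]; exact Or.inr (f1 u h1 x h2 h3).1)
    (by
      intro x hx y hy hxy
      rcases or_assoc.2 (hD x hx) with h | ⟨u, h1, h2, h3⟩ <;>
        rcases or_assoc.2 (hD y hy) with h' | ⟨u', h1', h2', h3'⟩
      · rw [hF1 x h, hF1 y h']; exact hxy.ne
      · rw [hF1 x h, hF2 u' h1' y h2' h3']; exact hmix x h u' y h1' h2' h3' hxy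
      · rw [hF1 y h', hF2 u h1 x h2 h3]; exact (hmix y h' u x h1 h2 h3 hxy.symm).symm
      · rw [hF2 u h1 x h2 h3, hF2 u' h1' y h2' h3']
        exact f3 u h1 x h2 h3 u' h1' y h2' h3' hxy)
    Finset.univ
  simp only [Finset.mem_union, Finset.mem_univ, or_true, true_implies] at g2 g3
  have hgK : ∀ x ∈ K, g x = x := by
    intro x hx
    rw [hKm] at hx
    rw [g1 x (by simp only [D, Finset.mem_filter, Finset.mem_univ, true_and]; tauto), hF1 x hx]
  let e : K ≃ Fin (d + 1) := K.equivFinOfCardEq hK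
  refine ⟨fun x => e ⟨g x, g2 x⟩, ?_, ?_⟩
  · intro x y hxy h
    exact g3 x y hxy (congrArg Subtype.val (e.injective h))
  · intro c
    obtain ⟨⟨a, ha⟩, rfl⟩ := e.surjective c
    refine ⟨a, by simp only [hgK a ha], ?_⟩
    intro c'
    obtain ⟨⟨b, hb⟩, rfl⟩ := e.surjective c'
    intro hne
    have hab : b ≠ a := by rintro rfl; exact hne rfl
    suffices ∃ u, G.Adj a u ∧ g u = b by
      obtain ⟨u, h1, h2⟩ := this
      exact ⟨u, h1, by simp only [h2]⟩
    rcases (hKm a).1 ha with rfl | hva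
    · rcases (hKm b).1 hb with h | h
      · exact absurd h hab
      · exact ⟨b, h, hgK b hb⟩
    · rcases (hKm b).1 hb with rfl | h
      · exact ⟨b, hva.symm, hgK b hb⟩
      · -- surjectivity by counting
        have c1 : ((G.neighborFinset a).erase v).card + 1 = d := by
          rw [Finset.card_erase_add_one (by simpa using hva.symm), hreg]
        have c2 : ((G.neighborFinset v).erase a).card + 1 = d := by
          rw [Finset.card_erase_add_one (by simpa using hva), hreg]
        have hs := Finset.surj_on_of_inj_on_of_card_le
          (s := (G.neighborFinset a).erase v) (t := (G.neighborFinset v).erase a)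
          (fun x _ => f x)
          (by
            intro x hx
            simp at hx ⊢
            exact (f1 a hva x hx.2 hx.1).symm)
          (by
            intro x y hx hy hxy
            simp at hx hy
            exact f2 a hva x hx.2 hx.1 y hy.2 hy.1 hxy)
          (by omega) b (by simp; exact ⟨hab, h⟩)
        obtain ⟨x, hx, hxb⟩ := hs
        simp at hx
        refine ⟨x, hx.2, ?_⟩
        rw [g1 x (by
          simp only [D, Finset.mem_filter, Finset.mem_univ, true_and]
          exact Or.inr (Or.inr ⟨a, hva, hx.2⟩)), hF2 a hva x hx.2 hx.1, hxb]

/-- If `G` is `d`-regular with girth 5, some vertex `v` satisfies `max_{u,v} ≤ (d-1)/2`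
for every edge `{u,v}` at `v`, and `max_P ≤ (d-1)/2` for every path `P` of length two,
then `φ(G) = d + 1`. -/
theorem bChromatic_eq_of_maxInter_le_girth_five
    {V : Type*} [Fintype V] (G : SimpleGraph V) [DecidableRel G.Adj] (d : ℕ)
    (hreg : G.IsRegularOfDegree d) (hgirth : G.egirth = 5)
    (v : V)
    (hedge : ∀ u : V, ∀ h : G.Adj v u,
      ((maxFiveCyclesInter G (G.subgraphOfAdj h) : ℝ)) ≤ ((d : ℝ) - 1) / 2)
    (hpath : ∀ P : G.Subgraph, IsTwoPath G P →
      ((maxFiveCyclesInter G P : ℝ)) ≤ ((d : ℝ) - 1) / 2) :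
    bChromaticNumber G = d + 1 := by
  refine IsGreatest.csSup_eq ⟨?_, ?_⟩
  · refine aux_lower G d (fun x => ?_) hgirth v hedge hpath
    rw [← hreg x, ← G.card_neighborFinset_eq_degree]
    congr!
  · rintro k ⟨C, hC⟩
    exact aux_upper G d k hreg C hC
end

section
/- Let G be a connected d-regular simple graph that contains no cycle of length 4 (as a subgraph). If the diameter of G is at least 6, then φ(G) = d + 1. -/
open SimpleGraph

section Helpers

variable {V : Type*} {G : SimpleGraph V}

theorem noFour_unique (h4 : NoFourCycle G) {a b u v : V} (hab : a ≠ b)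
    (h1 : G.Adj a u) (h2 : G.Adj b u) (h3 : G.Adj a v) (h5 : G.Adj b v) : u = v := by
  by_contra huv
  let w : G.Walk a a := .cons h1 (.cons h2.symm (.cons h5 (.cons h3.symm .nil)))
  refine h4 a w ?_ rfl
  have e1 := h1.ne
  have e2 := h2.ne
  have e3 := h3.ne
  have e5 := h5.ne
  rw [SimpleGraph.Walk.isCycle_def, SimpleGraph.Walk.isTrail_def]
  refine ⟨?_, ?_, ?_⟩
  · simp [w]
    grind
  · simp [w]
  · simp [w]
    grind

/-- the vertices coloured after the neighbours in `T` have been processed -/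
def ballSet (G : SimpleGraph V) (x : V) (T : Finset V) : Set V :=
  {v | v = x ∨ G.Adj x v ∨ ∃ z ∈ T, G.Adj z v}

/-- closed neighbourhood -/
def clN (G : SimpleGraph V) (x : V) : Set V := {v | v = x ∨ G.Adj x v}

theorem hall_aux_s7 {α β : Type*} [DecidableEq α] [DecidableEq β] (A : Finset α) (B : Finset β)
    (F : α → Finset β) (t : ℕ) (hAB : A.card = B.card) (ht : 2 * t ≤ A.card)
    (h1 : ∀ a ∈ A, (F a).card ≤ t)
    (h2 : ∀ b ∈ B, (A.filter (fun a => b ∈ F a)).card ≤ t) :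
    ∃ f : A → β, Function.Injective f ∧ ∀ a : A, f a ∈ B ∧ f a ∉ F a := by
  have := (Finset.all_card_le_biUnion_card_iff_exists_injective
    (fun a : A => B \ F a)).1 ?_
  · obtain ⟨f, hf, h⟩ := this
    exact ⟨f, hf, fun a => by simpa using h a⟩
  intro s
  rcases s.eq_empty_or_nonempty with rfl | ⟨a, ha⟩
  · simp
  by_cases hs : s.card + t ≤ B.card
  · have h3 : B \ F a ⊆ s.biUnion (fun a : A => B \ F a) :=
      Finset.subset_biUnion_of_mem (fun a : A => B \ F a) ha
    have h4 := Finset.card_le_card h3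
    have h5 := Finset.le_card_sdiff (F a) B
    have h6 := h1 a a.2
    omega
  · have h3 : B ⊆ s.biUnion (fun a : A => B \ F a) := by
      intro b hb
      by_contra hcon
      have h5 : ∀ a ∈ s, b ∈ F a := by
        intro a ha
        by_contra h
        exact hcon (Finset.mem_biUnion.2 ⟨a, ha, Finset.mem_sdiff.2 ⟨hb, h⟩⟩)
      have h6 : s.map (Function.Embedding.subtype _) ⊆ A.filter (fun a => b ∈ F a) := by
        intro a ha
        obtain ⟨a', ha', rfl⟩ := Finset.mem_map.1 ha
        exact Finset.mem_filter.2 ⟨a'.2, h5 a' ha'⟩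
      have h7 := Finset.card_le_card h6
      have h8 := h2 b hb
      rw [Finset.card_map] at h7
      omega
    have h4 := Finset.card_le_card h3
    have h5 : s.card ≤ A.card := by simpa using Finset.card_le_univ s
    omega

variable [Fintype V] [DecidableEq V] [DecidableRel G.Adj] {d : ℕ}

theorem step (hreg : G.IsRegularOfDegree d) (h4 : NoFourCycle G) (x w : V) (T : Finset V)
    (hw : G.Adj x w) (hT : ∀ z ∈ T, G.Adj x z) (hwT : w ∉ T) (hcard : 2 * T.card + 2 ≤ d)
    (c : V → Fin (d + 1)) (hx : Set.InjOn c (clN G x)) (hz : ∀ z ∈ T, Set.InjOn c (clN G z))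
    (hp : ∀ u ∈ ballSet G x T, ∀ v ∈ ballSet G x T, G.Adj u v → c u ≠ c v) :
    ∃ c' : V → Fin (d + 1), (∀ v ∈ clN G x, c' v = c v) ∧
      (∀ z ∈ insert w T, Set.InjOn c' (clN G z)) ∧
      (∀ u ∈ ballSet G x (insert w T), ∀ v ∈ ballSet G x (insert w T),
        G.Adj u v → c' u ≠ c' v) := by
  set N := fun v => G.neighborFinset v with hN
  have hNc : ∀ v, (insert v (N v)).card = d + 1 := by
    intro v
    rw [Finset.card_insert_of_notMem (by simp [N])]
    have := hreg v
    simpa [N] using this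
  set A := insert w (N w) \ insert x (N x) with hA
  set K := insert w (N w) ∩ insert x (N x) with hK
  set B := Finset.univ \ K.image c with hB
  set F := fun a => ((N a ∩ T.biUnion (fun z => N z \ insert x (N x))).image c) with hF
  have memA : ∀ v, v ∈ A ↔ G.Adj w v ∧ v ≠ x ∧ ¬ G.Adj x v := by
    intro v
    simp [A, N]
    grind
  have memK : ∀ v, v ∈ K ↔ (v = w ∨ G.Adj w v) ∧ (v = x ∨ G.Adj x v) := by
    intro v; simp [K, N]
  have hxw := hw.ne
  have cK : (K.image c).card = K.card := by
    apply Finset.card_image_of_injOn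
    intro u hu v hv
    exact hx ((memK u).1 hu).2 ((memK v).1 hv).2
  have cAK : A.card + K.card = d + 1 := by
    rw [← hNc w]; exact Finset.card_sdiff_add_card_inter _ _
  have cB : B.card + K.card = d + 1 := by
    have := Finset.card_sdiff_add_card_eq_card (Finset.subset_univ (K.image c))
    rw [cK, Finset.card_univ, Fintype.card_fin] at this
    exact this
  have cK3 : K.card ≤ 3 := by
    have h1 : K ⊆ {x, w} ∪ (N x ∩ N w) := by
      intro v hv
      have := (memK v).1 hv
      simp [N]
      grind
    have h2 : (N x ∩ N w).card ≤ 1 := by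
      rw [Finset.card_le_one]
      intro a ha b hb
      simp [N] at ha hb
      exact noFour_unique h4 hxw ha.1 ha.2 hb.1 hb.2
    have h3 := Finset.card_le_card h1
    have h4 := Finset.card_union_le {x, w} (N x ∩ N w)
    have h5 : ({x, w} : Finset V).card ≤ 2 := Finset.card_le_two
    omega
  have memF : ∀ a b, b ∈ F a ↔ ∃ z ∈ T, ∃ u, G.Adj a u ∧ G.Adj z u ∧ u ≠ x ∧ ¬ G.Adj x u ∧
      c u = b := by
    intro a b
    simp [F, N]
    grind
  obtain ⟨f, finj, hf⟩ := hall_aux_s7 A B F T.card (by omega) (by omega) (by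
      intro a ha
      have ha := (memA a).1 ha
      refine Finset.card_image_le.trans ?_
      have : N a ∩ T.biUnion (fun z => N z \ insert x (N x)) ⊆ T.biUnion (fun z => N a ∩ N z) := by
        intro v; simp; grind
      refine (Finset.card_le_card this).trans ?_
      refine (Finset.card_biUnion_le_card_mul T _ 1 ?_).trans (by simp)
      intro z hz
      rw [Finset.card_le_one]
      intro u hu v hv
      simp [N] at hu hv
      refine noFour_unique h4 ?_ hu.1 hu.2 hv.1 hv.2
      rintro rfl
      exact ha.2.2 (hT _ hz)) (by
      intro b hb
      have key : ∀ a, ∃ z, b ∈ F a → z ∈ T ∧ ∃ u, G.Adj a u ∧ G.Adj z u ∧ u ≠ x ∧ ¬ G.Adj x u ∧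
          c u = b := by
        intro a
        by_cases h : b ∈ F a
        · obtain ⟨z, h1, h2⟩ := (memF a b).1 h
          exact ⟨z, fun _ => ⟨h1, h2⟩⟩
        · exact ⟨a, fun h' => absurd h' h⟩
      choose g hg using key
      apply Finset.card_le_card_of_injOn g
      · intro a ha
        have ha := (Finset.mem_filter.1 ha).2
        exact (hg a ha).1
      · intro a ha a' ha' haa
        have ha := (Finset.mem_filter.1 ha)
        have ha' := (Finset.mem_filter.1 ha')
        obtain ⟨h1, u, h2, h3, h5, h6, h7⟩ := hg a ha.2
        obtain ⟨h1', u', h2', h3', h5', h6', h7'⟩ := hg a' ha'.2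
        rw [← haa] at h3'
        have : u = u' := hz _ h1 (Or.inr h3) (Or.inr h3') (h7.trans h7'.symm)
        subst this
        refine noFour_unique h4 (a := u) (b := w) ?_ h2.symm ((memA a).1 ha.1).1 h2'.symm
          ((memA a').1 ha'.1).1
        rintro rfl
        exact h6 hw)
  have hfB : ∀ a : A, ∀ v ∈ K, f a ≠ c v := by
    intro a v hv h
    have := (hf a).1
    simp only [B, Finset.mem_sdiff, Finset.mem_univ, true_and, Finset.mem_image] at this
    exact this ⟨v, hv, h.symm⟩
  set c' : V → Fin (d + 1) := fun v => if h : v ∈ A then f ⟨v, h⟩ else c v with hc'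
  have cpos : ∀ v (h : v ∈ A), c' v = f ⟨v, h⟩ := by intro v h; simp [c', h]
  have cneg : ∀ v, v ∉ A → c' v = c v := by intro v h; simp [c', h]
  have cinjA : ∀ u ∈ A, ∀ v ∈ A, c' u = c' v → u = v := by
    intro u hu v hv h
    rw [cpos u hu, cpos v hv] at h
    simpa using finj h
  have hxA : ∀ v ∈ clN G x, v ∉ A := by
    intro v hv h
    have := (memA v).1 h
    rcases hv with hv | hv
    · exact this.2.1 hv
    · exact this.2.2 hv
  have hzA : ∀ z ∈ T, ∀ v ∈ clN G z, v ∉ A := by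
    intro z hzT v hv h
    have hA := (memA v).1 h
    rcases hv with rfl | hv
    · exact hA.2.2 (hT _ hzT)
    · have := noFour_unique h4 (Ne.symm hA.2.1) (hT z hzT) hv.symm hw hA.1.symm
      exact hwT (this ▸ hzT)
  have wK : w ∈ K := (memK w).2 ⟨Or.inl rfl, Or.inr hw⟩
  refine ⟨c', fun v hv => cneg v (hxA v hv), ?_, ?_⟩
  · intro z hz'
    rcases Finset.mem_insert.1 hz' with rfl | hzT
    · have dich : ∀ v ∈ clN G z, v ∈ A ∨ v ∈ K := by
        intro v hv
        rw [memA, memK]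
        simp only [clN, Set.mem_ofPred_eq] at hv
        grind
      have hKA : ∀ v ∈ K, v ∉ A := fun v hv => hxA v ((memK v).1 hv).2
      intro u hu v hv huv
      rcases dich u hu with hu | hu <;> rcases dich v hv with hv | hv
      · exact cinjA u hu v hv huv
      · rw [cpos u hu, cneg v (hKA v hv)] at huv
        exact absurd huv (hfB _ v hv)
      · rw [cpos v hv, cneg u (hKA u hu)] at huv
        exact absurd huv.symm (hfB _ u hu)
      · rw [cneg v (hKA v hv), cneg u (hKA u hu)] at huv
        exact hx ((memK u).1 hu).2 ((memK v).1 hv).2 huv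
    · intro u hu v hv huv
      rw [cneg u (hzA z hzT u hu), cneg v (hzA z hzT v hv)] at huv
      exact hz z hzT hu hv huv
  · have dich : ∀ v ∈ ballSet G x (insert w T), v ∉ A → v ∈ ballSet G x T := by
      intro v hv hvA
      rw [memA] at hvA
      simp only [ballSet, Set.mem_ofPred_eq, Finset.mem_insert] at hv ⊢
      grind
    have mixed : ∀ u ∈ A, ∀ v, v ∉ A → v ∈ ballSet G x T → G.Adj u v → c' u ≠ c' v := by
      intro u hu v hv hvS huv
      rw [cpos u hu, cneg v hv]
      have hA := (memA u).1 hu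
      by_cases hvx : v = x
      · subst hvx; exact absurd huv.symm hA.2.2
      by_cases hvx' : G.Adj x v
      · have : v = w := noFour_unique h4 (Ne.symm hA.2.1) hvx' huv hw hA.1.symm
        subst this
        exact hfB _ _ wK
      · obtain h | h | ⟨z, hzT, hzv⟩ := hvS
        · exact absurd h hvx
        · exact absurd h hvx'
        · intro h
          exact (hf ⟨u, hu⟩).2 ((memF _ _).2 ⟨z, hzT, v, huv, hzv, hvx, hvx', h.symm⟩)
    intro u hu v hv huv
    by_cases huA : u ∈ A <;> by_cases hvA : v ∈ A
    · exact fun h => huv.ne (cinjA u huA v hvA h)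
    · exact mixed u huA v hvA (dich v hv hvA) huv
    · exact (mixed v hvA u huA (dich u hu huA) huv.symm).symm
    · rw [cneg u huA, cneg v hvA]
      exact hp u (dich u hu huA) v (dich v hv hvA) huv

theorem iter (hreg : G.IsRegularOfDegree d) (h4 : NoFourCycle G) (x : V)
    (c : V → Fin (d + 1)) (hx : Set.InjOn c (clN G x)) (T : Finset V) :
    (∀ z ∈ T, G.Adj x z) → 2 * T.card ≤ d →
    ∃ c' : V → Fin (d + 1), (∀ v ∈ clN G x, c' v = c v) ∧
      (∀ z ∈ T, Set.InjOn c' (clN G z)) ∧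
      (∀ u ∈ ballSet G x T, ∀ v ∈ ballSet G x T, G.Adj u v → c' u ≠ c' v) := by
  induction T using Finset.induction_on with
  | empty =>
    intro _ _
    refine ⟨c, fun _ _ => rfl, by simp, ?_⟩
    intro u hu v hv huv h
    have : ∀ u ∈ ballSet G x ∅, u ∈ clN G x := by
      intro u hu
      simpa [ballSet, clN] using hu
    exact huv.ne (hx (this u hu) (this v hv) h)
  | insert w T hw ih =>
    intro hT hc
    rw [Finset.card_insert_of_notMem hw] at hc
    obtain ⟨c', h1, h2, h3⟩ := ih (fun z hz => hT z (Finset.mem_insert_of_mem hz)) (by omega)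
    have hx' : Set.InjOn c' (clN G x) := hx.congr (fun v hv => (h1 v hv).symm)
    obtain ⟨c'', h1', h2', h3'⟩ := step hreg h4 x w T (hT w (Finset.mem_insert_self _ _))
      (fun z hz => hT z (Finset.mem_insert_of_mem hz)) hw (by omega) c' hx' h2 h3
    exact ⟨c'', fun v hv => (h1' v hv).trans (h1 v hv), h2', h3'⟩

theorem local_coloring (hconn : G.Connected) (hreg : G.IsRegularOfDegree d)
    (h4 : NoFourCycle G) (x : V) :
    ∃ (S : Set V) (c : V → Fin (d + 1)), (∀ v ∈ S, G.dist x v ≤ 2) ∧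
      (∀ u ∈ S, ∀ v ∈ S, G.Adj u v → c u ≠ c v) ∧
      ∀ k : Fin (d + 1), k.val ≤ d / 2 → ∃ v, c v = k ∧ clN G v ⊆ S ∧ Set.InjOn c (clN G v) := by
  have hcard : Fintype.card {v // v ∈ G.neighborFinset x} = d := by
    rw [Fintype.card_coe]; exact hreg x
  let e : {v // v ∈ G.neighborFinset x} ≃ Fin d := Fintype.equivFinOfCardEq hcard
  let c : V → Fin (d + 1) := fun v => if h : v ∈ G.neighborFinset x then (e ⟨v, h⟩).succ else 0
  have cx : c x = 0 := by simp [c]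
  have cn : ∀ v (h : v ∈ G.neighborFinset x), c v = (e ⟨v, h⟩).succ := by
    intro v h; simp only [c, dif_pos h]
  have hx : Set.InjOn c (clN G x) := by
    rintro u (rfl | hu) v (rfl | hv) h
    · rfl
    · rw [cx, cn v (by simpa using hv)] at h
      exact absurd h.symm (Fin.succ_ne_zero _)
    · rw [cx, cn u (by simpa using hu)] at h
      exact absurd h (Fin.succ_ne_zero _)
    · rw [cn u (by simpa using hu), cn v (by simpa using hv)] at h
      have := e.injective (Fin.succ_injective _ h)
      simpa using this
  let T : Finset V := (Finset.univ.filter (fun i : Fin d => i.val < d / 2)).image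
    (fun i => (e.symm i).1)
  have hTa : ∀ z ∈ T, G.Adj x z := by
    intro z hz
    obtain ⟨i, _, rfl⟩ := Finset.mem_image.1 hz
    exact (SimpleGraph.mem_neighborFinset _ _ _).1 (e.symm i).2
  have hTc : T.card ≤ d / 2 := by
    refine Finset.card_image_le.trans ?_
    have := Finset.card_le_card_of_injOn (s := Finset.univ.filter (fun i : Fin d => i.val < d / 2))
      (t := Finset.range (d / 2)) (fun i => i.val) (by intro i hi; simpa using hi)
      (fun i _ j _ h => Fin.ext h)
    simpa using this
  obtain ⟨c', h1, h2, h3⟩ := iter hreg h4 x c hx T hTa (by omega)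
  refine ⟨ballSet G x T, c', ?_, h3, ?_⟩
  · rintro v (rfl | hv | ⟨z, hz, hv⟩)
    · simp
    · rw [SimpleGraph.dist_eq_one_iff_adj.2 hv]; omega
    · have := hconn.dist_triangle (u := x) (v := z) (w := v)
      rw [SimpleGraph.dist_eq_one_iff_adj.2 hv, SimpleGraph.dist_eq_one_iff_adj.2 (hTa z hz)] at this
      exact this
  · intro k hk
    induction k using Fin.cases with
    | zero =>
      refine ⟨x, (h1 x (Or.inl rfl)).trans cx, ?_, hx.congr (fun v hv => (h1 v hv).symm)⟩
      rintro v (hv | hv)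
      · exact Or.inl hv
      · exact Or.inr (Or.inl hv)
    | succ i =>
      have hi : (e.symm i).1 ∈ T := by
        refine Finset.mem_image_of_mem _ (Finset.mem_filter.2 ⟨Finset.mem_univ _, ?_⟩)
        simp at hk; omega
      refine ⟨(e.symm i).1, ?_, ?_, h2 _ hi⟩
      · rw [h1 _ (Or.inr (hTa _ hi)), cn _ (e.symm i).2]
        simp
      · rintro v (rfl | hv)
        · exact Or.inr (Or.inl (hTa _ hi))
        · exact Or.inr (Or.inr ⟨_, hi, hv⟩)

theorem greedy_s7 (hreg : G.IsRegularOfDegree d) (n : ℕ) : ∀ (S : Finset V) (c : V → Fin (d + 1)),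
    (Finset.univ \ S).card = n → (∀ u ∈ S, ∀ v ∈ S, G.Adj u v → c u ≠ c v) →
    ∃ c' : V → Fin (d + 1), (∀ v ∈ S, c' v = c v) ∧ ∀ u v, G.Adj u v → c' u ≠ c' v := by
  induction n with
  | zero =>
    intro S c hS hp
    have : ∀ v, v ∈ S := by
      intro v
      by_contra h
      have := Finset.card_eq_zero.1 hS
      have h' : v ∈ Finset.univ \ S := by simp [h]
      simp [this] at h'
    exact ⟨c, fun _ _ => rfl, fun u v => hp u (this u) v (this v)⟩
  | succ n ih =>
    intro S c hS hp
    obtain ⟨w, hw⟩ : (Finset.univ \ S).Nonempty := Finset.card_pos.1 (by omega)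
    have hwS : w ∉ S := (Finset.mem_sdiff.1 hw).2
    obtain ⟨a, ha⟩ : ∃ a, a ∉ (G.neighborFinset w).image c := by
      by_contra! h
      have h1 : Finset.univ ⊆ (G.neighborFinset w).image c := fun a _ => h a
      have h2 := (Finset.card_le_card h1).trans Finset.card_image_le
      have h3 := hreg w
      simp at h2
      omega
    have ha' : ∀ v, G.Adj w v → c v ≠ a := by
      intro v hv h
      exact ha (Finset.mem_image.2 ⟨v, by simpa using hv, h⟩)
    obtain ⟨c', h1, h2⟩ := ih (insert w S) (Function.update c w a) (by
      have : Finset.univ \ insert w S = (Finset.univ \ S).erase w := by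
        ext; simp
      rw [this, Finset.card_erase_of_mem hw]; omega) (by
      intro u hu v hv huv
      have := huv.ne
      by_cases huw : u = w
      · subst huw
        rw [Function.update_self, Function.update_of_ne this.symm]
        exact (ha' v huv).symm
      · by_cases hvw : v = w
        · subst hvw
          rw [Function.update_self, Function.update_of_ne this]
          exact ha' u huv.symm
        · rw [Function.update_of_ne huw, Function.update_of_ne hvw]
          exact hp u (Finset.mem_of_mem_insert_of_ne hu huw) v
            (Finset.mem_of_mem_insert_of_ne hv hvw) huv)
    refine ⟨c', fun v hv => ?_, h2⟩
    rw [h1 v (Finset.mem_insert_of_mem hv), Function.update_of_ne]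
    rintro rfl
    exact hwS hv

theorem dominating (hreg : G.IsRegularOfDegree d) (c : V → Fin (d + 1)) (v : V)
    (h : Set.InjOn c (clN G v)) (k : Fin (d + 1)) (hk : k ≠ c v) : ∃ u, G.Adj v u ∧ c u = k := by
  have h1 : ((insert v (G.neighborFinset v)).image c).card = d + 1 := by
    rw [Finset.card_image_of_injOn, Finset.card_insert_of_notMem (by simp)]
    · have := hreg v
      simpa using this
    · intro u hu w hw
      exact h (by simpa [clN] using hu) (by simpa [clN] using hw)
  have h2 : (insert v (G.neighborFinset v)).image c = Finset.univ := by
    rw [← Finset.card_eq_iff_eq_univ, h1, Fintype.card_fin]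
  have h3 : k ∈ (insert v (G.neighborFinset v)).image c := by rw [h2]; simp
  obtain ⟨u, hu, rfl⟩ := Finset.mem_image.1 h3
  rcases Finset.mem_insert.1 hu with rfl | hu
  · exact absurd rfl hk
  · exact ⟨u, by simpa using hu, rfl⟩

theorem exists_bcol (hconn : G.Connected) (hreg : G.IsRegularOfDegree d) (h4 : NoFourCycle G)
    (x y : V) (hxy : 6 ≤ G.dist x y) : ∃ C : V → Fin (d + 1), IsBColoring G (d + 1) C := by
  classical
  obtain ⟨S, c, hS, hp, hd⟩ := local_coloring hconn hreg h4 x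
  obtain ⟨S', c', hS', hp', hd'⟩ := local_coloring hconn hreg h4 y
  have far : ∀ u ∈ S, ∀ v ∈ S', 2 ≤ G.dist u v := by
    intro u hu v hv
    have h1 := hS u hu
    have h2 := hS' v hv
    have h3 := hconn.dist_triangle (u := x) (v := u) (w := y)
    have h5 := hconn.dist_triangle (u := u) (v := v) (w := y)
    rw [SimpleGraph.dist_comm (u := v) (v := y)] at h5
    omega
  have disj : ∀ u ∈ S, u ∉ S' := by
    intro u hu hu'
    have := far u hu u hu'
    simp at this
  have nadj : ∀ u ∈ S, ∀ v ∈ S', ¬ G.Adj u v := by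
    intro u hu v hv h
    have := far u hu v hv
    rw [SimpleGraph.dist_eq_one_iff_adj.2 h] at this
    omega
  let b : V → Fin (d + 1) := fun v => if v ∈ S then c v else (c' v).rev
  have b1 : ∀ v ∈ S, b v = c v := fun v hv => by simp [b, hv]
  have b2 : ∀ v ∈ S', b v = (c' v).rev := fun v hv => by
    have : v ∉ S := fun h => disj v h hv
    simp [b, this]
  obtain ⟨C, hC, hC'⟩ := greedy_s7 hreg _ (Finset.univ.filter (fun v => v ∈ S ∨ v ∈ S')) b rfl (by
    intro u hu v hv huv
    simp only [Finset.mem_filter, Finset.mem_univ, true_and] at hu hv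
    rcases hu with hu | hu <;> rcases hv with hv | hv
    · rw [b1 u hu, b1 v hv]; exact hp u hu v hv huv
    · exact absurd huv (nadj u hu v hv)
    · exact absurd huv.symm (nadj v hv u hu)
    · rw [b2 u hu, b2 v hv]
      exact fun h => hp' u hu v hv huv (Fin.rev_injective h))
  have C1 : ∀ v ∈ S, C v = c v := fun v hv => (hC v (by simp [hv])).trans (b1 v hv)
  have C2 : ∀ v ∈ S', C v = (c' v).rev := fun v hv => (hC v (by simp [hv])).trans (b2 v hv)
  refine ⟨C, hC', fun k => ?_⟩
  suffices h : ∃ v, C v = k ∧ Set.InjOn C (clN G v) by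
    obtain ⟨v, rfl, hv⟩ := h
    exact ⟨v, rfl, fun k hk => dominating hreg C v hv k hk⟩
  by_cases hk : k.val ≤ d / 2
  · obtain ⟨v, rfl, h1, h2⟩ := hd k hk
    exact ⟨v, C1 v (h1 (Or.inl rfl)), h2.congr (fun u hu => (C1 u (h1 hu)).symm)⟩
  · obtain ⟨v, h0, h1, h2⟩ := hd' k.rev (by rw [Fin.val_rev]; omega)
    refine ⟨v, ?_, ?_⟩
    · rw [C2 v (h1 (Or.inl rfl)), h0, Fin.rev_rev]
    · intro u hu w hw h
      rw [C2 u (h1 hu), C2 w (h1 hw)] at h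
      exact h2 hu hw (Fin.rev_injective h)

theorem bcol_le (hreg : G.IsRegularOfDegree d) (k : ℕ) (C : V → Fin k)
    (hC : IsBColoring G k C) : k ≤ d + 1 := by
  rcases k with _ | k
  · omega
  obtain ⟨v, hv, h⟩ := hC.2 0
  have h1 : Finset.univ ⊆ (insert v (G.neighborFinset v)).image C := by
    intro a _
    by_cases ha : a = 0
    · subst ha
      exact Finset.mem_image.2 ⟨v, Finset.mem_insert_self _ _, hv⟩
    · obtain ⟨u, hu, rfl⟩ := h a ha
      exact Finset.mem_image_of_mem _ (Finset.mem_insert_of_mem (by simpa using hu))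
  have h2 := (Finset.card_le_card h1).trans Finset.card_image_le
  have h3 := Finset.card_insert_le v (G.neighborFinset v)
  have h4 := hreg v
  simp at h2 h3
  omega

end Helpers

/-- A connected `d`-regular graph with no 4-cycle and diameter at least 6 has
b-chromatic number `d + 1`. -/
theorem bChromatic_eq_of_diam_ge_six
    {V : Type*} [Fintype V] (G : SimpleGraph V) [DecidableRel G.Adj] (d : ℕ)
    (hconn : G.Connected) (hreg : G.IsRegularOfDegree d) (h4 : NoFourCycle G)
    (hdiam : 6 ≤ G.diam) :
    bChromaticNumber G = d + 1 := by
  classical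
  have := hconn.nonempty
  obtain ⟨x, y, hxy⟩ := G.exists_dist_eq_diam
  have hmem := exists_bcol hconn hreg h4 x y (by omega)
  unfold bChromaticNumber
  apply IsGreatest.csSup_eq
  refine ⟨hmem, ?_⟩
  rintro k ⟨C, hC⟩
  exact bcol_le hreg k C hC
end

section
/- Let d be a nonnegative integer and let G be a d-regular simple graph that contains no cycle of length 4 (as a subgraph) with vertex connectivity κ(G) < (2d-1)/3. If there exists a set U of vertices of G with |U| = κ(G) such that the graph G \ U has at least three connected components, then φ(G) = d + 1. -/
open SimpleGraph

/-- The vertex connectivity of `G`: the minimum size of a set `U` of vertices such that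
`G \ U` is disconnected or has exactly one vertex. -/
noncomputable def vertexConnectivity {V : Type*} (G : SimpleGraph V) : ℕ :=
  sInf {k : ℕ | ∃ U : Set V, U.ncard = k ∧
    (¬ (G.induce Uᶜ).Preconnected ∨ (Uᶜ : Set V).ncard = 1)}

/-- Two distinct vertices have at most one common neighbour. -/
def CNF {V : Type*} (G : SimpleGraph V) : Prop :=
  ∀ a b x y : V, a ≠ b → x ≠ y → G.Adj a x → G.Adj b x → G.Adj a y → G.Adj b y → False

lemma cnf_of_noFourCycle {V : Type*} (G : SimpleGraph V) (h4 : NoFourCycle G) : CNF G := by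
  intro a b x y hab hxy hax hbx hay hby
  have h := h4 a (Walk.cons hax (Walk.cons hbx.symm (Walk.cons hby (Walk.cons hay.symm Walk.nil))))
  apply h
  · rw [Walk.cons_isCycle_iff]
    have := hax.ne
    have := hbx.ne
    have := hay.ne
    have := hby.ne
    refine ⟨?_, ?_⟩
    · simp only [Walk.cons_isPath_iff, Walk.support_cons, Walk.support_nil]
      simp
      grind
    · simp
      grind
  · simp

/-- Hall-type lemma. -/
lemma hall_bij {α β : Type*} [DecidableEq α] [DecidableEq β] (b : β) (S : Finset α) (L : Finset β)
    (bad : α → β → Prop) (r : ℕ)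
    (hcard : S.card = L.card) (hr : 2 * r ≤ S.card)
    (h1 : ∀ x ∈ S, ∃ F : Finset β, F.card ≤ r ∧ ∀ c ∈ L, bad x c → c ∈ F)
    (h2 : ∀ c ∈ L, ∃ F : Finset α, F.card ≤ r ∧ ∀ x ∈ S, bad x c → x ∈ F) :
    ∃ g : α → β, Set.InjOn g S ∧ ∀ x ∈ S, g x ∈ L ∧ ¬ bad x (g x) := by
  classical
  have key : ∀ s : Finset S, s.card ≤ (s.biUnion (fun x => L.filter (fun c => ¬ bad x c))).card := by
    intro s
    by_contra hlt
    push Not at hlt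
    have hsS : s.card ≤ S.card := by
      have := Finset.card_le_univ s
      simpa using this
    have hne : s.Nonempty := by
      rw [← Finset.card_pos]; omega
    obtain ⟨x, hx⟩ := hne
    obtain ⟨F, hF, hF2⟩ := h1 x x.2
    have e1 : L.card ≤ (s.biUnion (fun x => L.filter (fun c => ¬ bad x c))).card + F.card := by
      refine le_trans (Finset.card_le_card ?_) (Finset.card_union_le _ _)
      intro c hc
      rw [Finset.mem_union, Finset.mem_biUnion]
      by_cases hb : bad x c
      · exact Or.inr (hF2 c hc hb)
      · exact Or.inl ⟨x, hx, by simp [hc, hb]⟩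
    have hnot : ∃ c ∈ L, c ∉ s.biUnion (fun x => L.filter (fun c => ¬ bad x c)) := by
      by_contra hcon
      push Not at hcon
      have := Finset.card_le_card (show L ⊆ _ from hcon)
      omega
    obtain ⟨c, hc, hcn⟩ := hnot
    obtain ⟨F', hF', hF'2⟩ := h2 c hc
    have e2 : s.card ≤ F'.card := by
      rw [← Finset.card_map (Function.Embedding.subtype _)]
      apply Finset.card_le_card
      intro y hy
      rw [Finset.mem_map] at hy
      obtain ⟨y, hy, rfl⟩ := hy
      apply hF'2 _ y.2
      by_contra hb
      apply hcn
      rw [Finset.mem_biUnion]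
      exact ⟨y, hy, by simp [hc]; exact hb⟩
    omega
  obtain ⟨f, hfi, hf⟩ := (Finset.all_card_le_biUnion_card_iff_exists_injective _).1 key
  by_cases hS : S.Nonempty
  · obtain ⟨x0, hx0⟩ := hS
    refine ⟨fun x => if h : x ∈ S then f ⟨x, h⟩ else f ⟨x0, hx0⟩, ?_, ?_⟩
    · intro x hx y hy hxy
      have hx' : x ∈ S := hx
      have hy' : y ∈ S := hy
      simp only [hx', hy', dif_pos] at hxy
      simpa using hfi hxy
    · intro x hx
      have := hf ⟨x, hx⟩
      simpa [hx] using this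
  · rw [Finset.not_nonempty_iff_eq_empty] at hS
    subst hS
    exact ⟨fun _ => b, by simp, by simp⟩

lemma extend_coloring {V : Type*} [Fintype V] (G : SimpleGraph V) [DecidableRel G.Adj] (d : ℕ)
    (hreg : G.IsRegularOfDegree d) (D : Finset V) (c : V → Fin (d+1))
    (hc : ∀ x ∈ D, ∀ y ∈ D, G.Adj x y → c x ≠ c y) :
    ∃ c' : V → Fin (d+1), (∀ x ∈ D, c' x = c x) ∧ ∀ x y, G.Adj x y → c' x ≠ c' y := by
  classical
  have : ∀ T : Finset V, ∃ c' : V → Fin (d+1), (∀ x ∈ D, c' x = c x) ∧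
      ∀ x ∈ D ∪ T, ∀ y ∈ D ∪ T, G.Adj x y → c' x ≠ c' y := by
    intro T
    induction T using Finset.induction_on with
    | empty => exact ⟨c, fun _ _ => rfl, by simpa using hc⟩
    | insert a T ha ih =>
      obtain ⟨c', h1, h2⟩ := ih
      by_cases haD : a ∈ D
      · refine ⟨c', h1, ?_⟩
        have : D ∪ insert a T = D ∪ T := by
          ext z; simp only [Finset.mem_union, Finset.mem_insert]; grind
        rw [this]; exact h2
      · have hex : ∃ q : Fin (d+1), q ∉ (G.neighborFinset a).image c' := by
          by_contra hcon
          push Not at hcon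
          have h3 := Finset.card_le_card (show (Finset.univ : Finset (Fin (d+1))) ⊆ _ from fun q _ => hcon q)
          have h4 := Finset.card_image_le (s := G.neighborFinset a) (f := c')
          have h5 : (G.neighborFinset a).card = d := by
            rw [G.card_neighborFinset_eq_degree]; exact hreg a
          simp at h3
          omega
        obtain ⟨q, hq⟩ := hex
        have hq' : ∀ y, G.Adj a y → c' y ≠ q := by
          intro y hy hh
          apply hq
          rw [Finset.mem_image]
          exact ⟨y, by simpa using hy, hh⟩
        refine ⟨fun x => if x = a then q else c' x, ?_, ?_⟩
        · intro x hx
          have : x ≠ a := fun h => haD (h ▸ hx)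
          simp [this, h1 x hx]
        · intro x hx y hy hxy
          by_cases hxa : x = a
          · subst hxa
            have : y ≠ x := hxy.ne'
            simp only [this, if_true, if_false]
            exact (hq' y hxy).symm
          · by_cases hya : y = a
            · subst hya
              simp only [hxa, if_true, if_false]
              exact hq' x hxy.symm
            · simp only [hxa, hya, if_false]
              apply h2 _ _ _ _ hxy
              · simp only [Finset.mem_union, Finset.mem_insert] at hx ⊢; tauto
              · simp only [Finset.mem_union, Finset.mem_insert] at hy ⊢; tauto
  obtain ⟨c', h1, h2⟩ := this Finset.univ
  exact ⟨c', h1, fun x y h => h2 x (by simp) y (by simp) h⟩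

/-- closed neighbourhood -/
noncomputable def cN {V : Type*} [Fintype V] (G : SimpleGraph V) (v : V) : Finset V := by
  classical exact Finset.univ.filter (fun x => x = v ∨ G.Adj v x)

lemma mem_cN {V : Type*} [Fintype V] (G : SimpleGraph V) (v x : V) :
    x ∈ cN G v ↔ x = v ∨ G.Adj v x := by
  classical
  simp [cN]

lemma card_cN {V : Type*} [Fintype V] (G : SimpleGraph V) [DecidableRel G.Adj] (d : ℕ)
    (hreg : G.IsRegularOfDegree d) (v : V) : (cN G v).card = d + 1 := by
  classical
  have : cN G v = insert v (G.neighborFinset v) := by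
    ext x; simp [mem_cN]
  rw [this, Finset.card_insert_of_notMem (by simp), G.card_neighborFinset_eq_degree, hreg v]

open Classical in
lemma local_coloring_s10 {V : Type*} [Fintype V] (G : SimpleGraph V) [DecidableRel G.Adj] (d : ℕ)
    (hreg : G.IsRegularOfDegree d) (hC : CNF G) (v : V) (f : V → Fin (d+1))
    (hf : Set.InjOn f (cN G v)) (W : Finset V) (hW : ∀ w ∈ W, G.Adj v w) (hm : 2 * W.card ≤ d) :
    ∃ c : V → Fin (d+1), (∀ x ∈ cN G v, c x = f x) ∧ (∀ w ∈ W, Set.InjOn c (cN G w)) ∧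
      ∀ x ∈ cN G v ∪ W.biUnion (cN G), ∀ y ∈ cN G v ∪ W.biUnion (cN G), G.Adj x y → c x ≠ c y := by
  induction W using Finset.induction_on with
  | empty =>
    refine ⟨f, fun _ _ => rfl, by simp, ?_⟩
    intro x hx y hy hxy h
    simp only [Finset.biUnion_empty, Finset.union_empty] at hx hy
    exact hxy.ne (hf hx hy h)
  | insert w W hwW ih =>
    rw [Finset.card_insert_of_notMem hwW] at hm
    obtain ⟨c, h1, h2, h3⟩ := ih (fun z hz => hW z (Finset.mem_insert_of_mem hz)) (by omega)
    have hvw : G.Adj v w := hW w (by simp)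
    have hW' : ∀ z ∈ W, G.Adj v z := fun z hz => hW z (Finset.mem_insert_of_mem hz)
    have hwne : ∀ z ∈ W, z ≠ w := fun z hz h => hwW (h ▸ hz)
    set I := cN G v ∩ cN G w with hI
    set S := cN G w \ cN G v with hS
    set L := Finset.univ \ I.image f with hL
    have hIc : I.card ≤ 3 := by
      by_contra hcon
      push Not at hcon
      have h5 : 2 ≤ ((I.erase v).erase w).card := by
        have := Finset.pred_card_le_card_erase (s := I) (a := v)
        have := Finset.pred_card_le_card_erase (s := I.erase v) (a := w)
        omega
      obtain ⟨x, hx, y, hy, hxy⟩ := Finset.one_lt_card.1 h5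
      simp only [Finset.mem_erase, hI, Finset.mem_inter, mem_cN] at hx hy
      exact hC v w x y hvw.ne hxy (by tauto) (by tauto) (by tauto) (by tauto)
    have hSc : S.card + I.card = d + 1 := by
      rw [← card_cN G d hreg w, hS, hI, Finset.inter_comm, Finset.card_sdiff_add_card_inter]
    have hLc : L.card + I.card = d + 1 := by
      have e : (I.image f).card = I.card :=
        Finset.card_image_of_injOn (fun x hx y hy h => hf (Finset.mem_inter.1 hx).1 (Finset.mem_inter.1 hy).1 h)
      have := Finset.card_sdiff_add_card_inter (Finset.univ : Finset (Fin (d+1))) (I.image f)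
      simp only [Finset.univ_inter, Finset.card_univ, Fintype.card_fin] at this
      rw [hL, ← e]; exact this
    -- S-vertices
    have hSmem : ∀ x ∈ S, G.Adj w x ∧ x ≠ v ∧ ¬ G.Adj v x := by
      intro x hx
      simp only [hS, Finset.mem_sdiff, mem_cN] at hx
      refine ⟨?_, by tauto, by tauto⟩
      rcases hx.1 with h | h
      · subst h; tauto
      · exact h
    have hSnW : ∀ x ∈ S, ∀ z ∈ W, ¬ G.Adj z x := by
      intro x hx z hz hzx
      obtain ⟨a, b, e⟩ := hSmem x hx
      exact hC v x w z b.symm (hwne z hz).symm hvw a.symm (hW' z hz) hzx.symm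
    set D := cN G v ∪ W.biUnion (cN G) with hD
    have hSD : ∀ x ∈ S, x ∉ D := by
      intro x hx hxD
      obtain ⟨a, b, e⟩ := hSmem x hx
      simp only [hD, Finset.mem_union, Finset.mem_biUnion, mem_cN] at hxD
      rcases hxD with h | ⟨z, hz, h⟩
      · tauto
      · rcases h with h | h
        · subst h; exact e (hW' x hz)
        · exact hSnW x hx z hz h
    -- the Hall step
    obtain ⟨g, hg1, hg2⟩ := hall_bij (0 : Fin (d+1)) S L
      (fun x q => ∃ z ∈ W, ∃ y ∈ cN G z \ cN G v, G.Adj x y ∧ c y = q) W.card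
      (by omega) (by omega)
      (by
        intro x hx
        obtain ⟨a, b, e⟩ := hSmem x hx
        have : ∀ z ∈ W, ∃ q : Fin (d+1), ∀ y ∈ cN G z \ cN G v, G.Adj x y → c y = q := by
          intro z hz
          by_cases hh : ∃ y ∈ cN G z \ cN G v, G.Adj x y
          · obtain ⟨y, hy, hxy⟩ := hh
            refine ⟨c y, ?_⟩
            intro y' hy' hxy'
            by_contra hne
            have hne' : y ≠ y' := fun h => hne (by rw [h])
            simp only [Finset.mem_sdiff, mem_cN] at hy hy'
            have hzv := hW' z hz
            have hxz : x ≠ z := by rintro rfl; exact e hzv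
            refine hC x z y y' hxz hne' hxy ?_ hxy' ?_
            · rcases hy.1 with h | h
              · subst h; tauto
              · exact h
            · rcases hy'.1 with h | h
              · subst h; tauto
              · exact h
          · push Not at hh
            exact ⟨0, fun y hy hxy => absurd hxy (hh y hy)⟩
        choose! q hq using this
        refine ⟨W.image q, Finset.card_image_le, ?_⟩
        rintro c' - ⟨z, hz, y, hy, hxy, rfl⟩
        rw [Finset.mem_image]
        exact ⟨z, hz, (hq z hz y hy hxy).symm⟩)
      (by
        intro q hq
        have : ∀ z ∈ W, ∃ x0 : V, ∀ x ∈ S, (∃ y ∈ cN G z \ cN G v, G.Adj x y ∧ c y = q) → x = x0 := by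
          intro z hz
          by_cases hh : ∃ x ∈ S, (∃ y ∈ cN G z \ cN G v, G.Adj x y ∧ c y = q)
          · obtain ⟨x, hx, y, hy, hxy, hcy⟩ := hh
            refine ⟨x, ?_⟩
            rintro x' hx' ⟨y', hy', hxy', hcy'⟩
            by_contra hne
            have hyy : y = y' := by
              apply h2 z hz
              · exact Finset.mem_coe.2 (Finset.mem_sdiff.1 hy).1
              · exact Finset.mem_coe.2 (Finset.mem_sdiff.1 hy').1
              · rw [hcy, hcy']
            subst hyy
            have hyw : y ≠ w := by
              rintro rfl
              simp only [Finset.mem_sdiff, mem_cN] at hy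
              tauto
            exact hC x' x y w hne hyw hxy' hxy (hSmem x' hx').1.symm (hSmem x hx).1.symm
          · push Not at hh
            refine ⟨v, fun x hx ⟨y, hy, hxy, hcy⟩ => absurd hcy (hh x hx y hy hxy)⟩
        choose! p hp using this
        refine ⟨W.image p, Finset.card_image_le, ?_⟩
        rintro x hx ⟨z, hz, y, hy, hxy, hcy⟩
        rw [Finset.mem_image]
        exact ⟨z, hz, (hp z hz x hx ⟨y, hy, hxy, hcy⟩).symm⟩)
    have hDS : ∀ x ∈ D, x ∉ S := fun x hx h => hSD x h hx
    have hvD : ∀ x ∈ cN G v, x ∈ D := fun x hx => Finset.mem_union_left _ hx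
    have hwcN : w ∈ cN G v := (mem_cN G v w).2 (Or.inr hvw)
    have hgI : ∀ x ∈ S, ∀ y ∈ I, g x ≠ f y := by
      intro x hx y hy h
      have := (hg2 x hx).1
      rw [hL, Finset.mem_sdiff] at this
      apply this.2
      rw [h]
      exact Finset.mem_image_of_mem f hy
    -- mixed edges
    have hmix : ∀ x ∈ S, ∀ y ∈ D, G.Adj x y → g x ≠ c y := by
      intro x hx y hy hxy h
      obtain ⟨a, b, e⟩ := hSmem x hx
      by_cases hyv : y ∈ cN G v
      · by_cases hyw : y = w
        · subst hyw
          rw [h1 y hyv] at h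
          refine hgI x hx y ?_ h
          rw [hI, Finset.mem_inter]
          exact ⟨hyv, (mem_cN _ _ _).2 (Or.inl rfl)⟩
        · rcases (mem_cN G v y).1 hyv with h' | h'
          · subst h'; exact e hxy.symm
          · exact hC v x y w b.symm hyw h' hxy hvw a.symm
      · apply (hg2 x hx).2
        simp only [hD, Finset.mem_union, Finset.mem_biUnion] at hy
        rcases hy with hy | ⟨z, hz, hy⟩
        · exact absurd hy hyv
        · exact ⟨z, hz, y, Finset.mem_sdiff.2 ⟨hy, hyv⟩, hxy, h.symm⟩
    have hDnew : ∀ x ∈ cN G v ∪ (insert w W).biUnion (cN G), x ∈ D ∨ x ∈ S := by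
      intro x hx
      simp only [hD, hS, Finset.mem_union, Finset.mem_biUnion, Finset.mem_insert, Finset.mem_sdiff] at hx ⊢
      rcases hx with hx | ⟨z, hz | hz, hx⟩
      · tauto
      · subst hz; tauto
      · exact Or.inl (Or.inr ⟨z, hz, hx⟩)
    refine ⟨fun x => if x ∈ S then g x else c x, ?_, ?_, ?_⟩
    · intro x hx
      simp only [hDS x (hvD x hx), if_false]
      exact h1 x hx
    · intro z hz
      rcases Finset.mem_insert.1 hz with rfl | hz
      · intro x hx y hy hxy
        have hx' : x ∈ cN G z := hx
        have hy' : y ∈ cN G z := hy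
        by_cases hxS : x ∈ S <;> by_cases hyS : y ∈ S <;> simp only [hxS, hyS, if_true, if_false] at hxy
        · exact hg1 hxS hyS hxy
        · exfalso
          have hyv : y ∈ cN G v := by
            by_contra hn; exact hyS (Finset.mem_sdiff.2 ⟨hy', hn⟩)
          rw [h1 y hyv] at hxy
          exact hgI x hxS y (Finset.mem_inter.2 ⟨hyv, hy'⟩) hxy
        · exfalso
          have hxv : x ∈ cN G v := by
            by_contra hn; exact hxS (Finset.mem_sdiff.2 ⟨hx', hn⟩)
          rw [h1 x hxv] at hxy
          exact hgI y hyS x (Finset.mem_inter.2 ⟨hxv, hx'⟩) hxy.symm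
        · have hyv : y ∈ cN G v := by
            by_contra hn; exact hyS (Finset.mem_sdiff.2 ⟨hy', hn⟩)
          have hxv : x ∈ cN G v := by
            by_contra hn; exact hxS (Finset.mem_sdiff.2 ⟨hx', hn⟩)
          rw [h1 x hxv, h1 y hyv] at hxy
          exact hf hxv hyv hxy
      · intro x hx y hy hxy
        have hx' : x ∈ D := Finset.mem_union_right _ (Finset.mem_biUnion.2 ⟨z, hz, hx⟩)
        have hy' : y ∈ D := Finset.mem_union_right _ (Finset.mem_biUnion.2 ⟨z, hz, hy⟩)
        simp only [hDS x hx', hDS y hy', if_false] at hxy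
        exact h2 z hz hx hy hxy
    · intro x hx y hy hxy
      rcases hDnew x hx with hx | hx <;> rcases hDnew y hy with hy | hy
      · simp only [hDS x hx, hDS y hy, if_false]
        exact h3 x hx y hy hxy
      · simp only [hDS x hx, hy, if_false, if_true]
        exact (hmix y hy x hx hxy.symm).symm
      · simp only [hDS y hy, hx, if_false, if_true]
        exact hmix x hx y hy hxy
      · simp only [hx, hy, if_true]
        intro h
        exact hxy.ne (hg1 hx hy h)

/-- A star centred at `v` realises any small set `T` of colours by dominating vertices. -/
lemma star_coloring {V : Type*} [Fintype V] (G : SimpleGraph V) [DecidableRel G.Adj] (d : ℕ)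
    (hreg : G.IsRegularOfDegree d) (hC : CNF G) (v : V)
    (W : Finset V) (hW : ∀ w ∈ W, G.Adj v w) (hm : 2 * W.card ≤ d)
    (T : Finset (Fin (d+1))) (hT : T.card ≤ W.card + 1) (A : Set V)
    (hvA : ∀ x ∈ cN G v, x ∈ A) (hWA : ∀ w ∈ W, ∀ x ∈ cN G w, x ∈ A) :
    ∃ (c : V → Fin (d+1)) (D : Finset V), (∀ x ∈ D, x ∈ A) ∧
      (∀ x ∈ D, ∀ y ∈ D, G.Adj x y → c x ≠ c y) ∧
      ∀ q ∈ T, ∃ z, c z = q ∧ cN G z ⊆ D ∧ Set.InjOn c (cN G z) := by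
  classical
  have hvW : v ∉ W := fun h => (hW v h).ne rfl
  have hc' : T.card ≤ (insert v W).card := by rw [Finset.card_insert_of_notMem hvW]; exact hT
  obtain ⟨R, hR, hRc⟩ := Finset.exists_subset_card_eq hc'
  obtain ⟨e⟩ : Nonempty (T ≃ R) := ⟨Finset.equivOfCardEq hRc.symm⟩
  have hsub : insert v W ⊆ cN G v := by
    intro x hx
    rw [mem_cN]
    rcases Finset.mem_insert.1 hx with h | h
    · exact Or.inl h
    · exact Or.inr (hW x h)
  obtain ⟨g, hg⟩ := Finset.exists_equiv_extend_of_card_eq (α := Fin (d+1)) (t := cN G v)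
    (by rw [card_cN G d hreg v, Fintype.card_fin]) (s := T)
    (f := fun q => if h : q ∈ T then (e ⟨q, h⟩ : V) else v)
    (by
      intro x hx
      obtain ⟨q, hq, rfl⟩ := Finset.mem_image.1 hx
      simp only [hq, dif_pos]
      exact hsub (hR (e ⟨q, hq⟩).2))
    (by
      intro x hx y hy hxy
      have hx' : x ∈ T := hx
      have hy' : y ∈ T := hy
      simp only [hx', hy', dif_pos] at hxy
      have := e.injective (Subtype.ext hxy)
      simpa using this)
  set f : V → Fin (d+1) := fun x => if h : x ∈ cN G v then g.symm ⟨x, h⟩ else 0 with hf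
  have hfi : Set.InjOn f (cN G v) := by
    intro x hx y hy hxy
    have hx' : x ∈ cN G v := hx
    have hy' : y ∈ cN G v := hy
    simp only [hf, hx', hy', dif_pos] at hxy
    have := g.symm.injective hxy
    simpa using this
  obtain ⟨c, h1, h2, h3⟩ := local_coloring_s10 G d hreg hC v f hfi W hW hm
  refine ⟨c, cN G v ∪ W.biUnion (cN G), ?_, h3, ?_⟩
  · intro x hx
    simp only [Finset.mem_union, Finset.mem_biUnion] at hx
    rcases hx with hx | ⟨w, hw, hx⟩
    · exact hvA x hx
    · exact hWA w hw x hx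
  · intro q hq
    have hgq : (g q : V) ∈ insert v W := by
      rw [hg q hq]
      simp only [hq, dif_pos]
      exact hR (e ⟨q, hq⟩).2
    refine ⟨g q, ?_, ?_, ?_⟩
    · rw [h1 _ (g q).2]
      simp [hf]
    · rcases Finset.mem_insert.1 hgq with h | h
      · rw [h]; exact Finset.subset_union_left
      · intro x hx
        exact Finset.mem_union_right _ (Finset.mem_biUnion.2 ⟨_, h, hx⟩)
    · rcases Finset.mem_insert.1 hgq with h | h
      · rw [h]
        intro x hx y hy hxy
        rw [h1 x hx, h1 y hy] at hxy
        exact hfi hx hy hxy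
      · exact h2 _ h

open Classical in
lemma sum_le_U {V : Type*} [Fintype V] (G : SimpleGraph V) [DecidableRel G.Adj]
    (hC : CNF G) (U : Finset V) (a : V) (ha : a ∉ U) (X : Finset V) (hX : ∀ w ∈ X, G.Adj a w) :
    ∑ w ∈ X, (G.neighborFinset w ∩ U).card ≤ U.card := by
  rw [← Finset.card_biUnion]
  · apply Finset.card_le_card
    intro x hx
    rw [Finset.mem_biUnion] at hx
    obtain ⟨w, _, hx⟩ := hx
    exact (Finset.mem_inter.1 hx).2
  · intro w hw z hz hne
    refine Finset.disjoint_left.2 ?_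
    intro u hu hu'
    simp only [Finset.mem_inter, mem_neighborFinset] at hu hu'
    exact hC a u w z (fun h => ha (h ▸ hu.2)) hne (hX w hw) hu.1.symm (hX z hz) hu'.1.symm

open Classical in
lemma good_vertex {V : Type*} [Fintype V] (G : SimpleGraph V) [DecidableRel G.Adj] (d : ℕ)
    (hreg : G.IsRegularOfDegree d) (hC : CNF G) (U : Finset V) (hk : 3 * U.card + 2 ≤ 2 * d)
    (A : Set V) (hAU : ∀ x ∈ A, x ∉ U) (hA : ∀ x ∈ A, ∀ y, G.Adj x y → y ∉ U → y ∈ A)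
    (a : V) (ha : a ∈ A) : ∃ v ∈ A, ∀ u, G.Adj v u → u ∉ U := by
  by_contra hcon
  push Not at hcon
  have hdeg : ∀ x, (G.neighborFinset x \ U).card + (G.neighborFinset x ∩ U).card = d := by
    intro x
    rw [Finset.card_sdiff_add_card_inter, G.card_neighborFinset_eq_degree, hreg x]
  have hin : ∀ x, (G.neighborFinset x ∩ U).card ≤ U.card :=
    fun x => Finset.card_le_card Finset.inter_subset_right
  have hone : ∀ x ∈ A, (G.neighborFinset x \ U).card ≤ U.card := by
    intro x hx
    refine le_trans ?_ (sum_le_U G hC U x (hAU x hx) (G.neighborFinset x \ U) (by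
      intro w hw; simpa using (Finset.mem_sdiff.1 hw).1))
    rw [Finset.card_eq_sum_ones]
    apply Finset.sum_le_sum
    intro w hw
    rw [Finset.mem_sdiff, mem_neighborFinset] at hw
    obtain ⟨u, hu1, hu2⟩ := hcon w (hA x hx w hw.1 hw.2)
    exact Finset.card_pos.2 ⟨u, by simp [hu1, hu2]⟩
  have hlow : ∀ x ∈ A, d - U.card ≤ (G.neighborFinset x ∩ U).card := by
    intro x hx
    have := hone x hx
    have := hdeg x
    omega
  have hsum := sum_le_U G hC U a (hAU a ha) (G.neighborFinset a \ U) (by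
      intro w hw; simpa using (Finset.mem_sdiff.1 hw).1)
  have h2 : (G.neighborFinset a \ U).card * (d - U.card) ≤ U.card := by
    refine le_trans ?_ hsum
    rw [← smul_eq_mul]
    apply Finset.card_nsmul_le_sum
    intro w hw
    rw [Finset.mem_sdiff, mem_neighborFinset] at hw
    exact hlow w (hA a ha w hw.1 hw.2)
  have h3 : d - U.card ≤ (G.neighborFinset a \ U).card := by
    have := hdeg a
    have := hin a
    omega
  obtain ⟨e, he⟩ : ∃ e, e = d - U.card := ⟨_, rfl⟩
  rw [← he] at h2 h3
  have h4 : U.card + 2 ≤ 2 * e := by omega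
  have h5 : e * e ≤ U.card := le_trans (Nat.mul_le_mul_right e h3) h2
  zify at h4 h5
  nlinarith [sq_nonneg ((e : ℤ) - 1)]

open Classical in
lemma part_coloring {V : Type*} [Fintype V] (G : SimpleGraph V) [DecidableRel G.Adj] (d : ℕ)
    (hreg : G.IsRegularOfDegree d) (hC : CNF G) (U : Finset V) (hk : 3 * U.card + 2 ≤ 2 * d)
    (A : Set V) (hAU : ∀ x ∈ A, x ∉ U) (hA : ∀ x ∈ A, ∀ y, G.Adj x y → y ∉ U → y ∈ A)
    (hne : A.Nonempty) (T : Finset (Fin (d+1))) (hT : T.card ≤ d / 3 + 1) :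
    ∃ (c : V → Fin (d+1)) (D : Finset V), (∀ x ∈ D, x ∈ A) ∧
      (∀ x ∈ D, ∀ y ∈ D, G.Adj x y → c x ≠ c y) ∧
      ∀ q ∈ T, ∃ z, c z = q ∧ cN G z ⊆ D ∧ Set.InjOn c (cN G z) := by
  obtain ⟨a, ha⟩ := hne
  obtain ⟨v, hv, hvU⟩ := good_vertex G d hreg hC U hk A hAU hA a ha
  set X := (G.neighborFinset v).filter (fun w => ∀ u, G.Adj w u → u ∉ U) with hX
  set Y := (G.neighborFinset v).filter (fun w => ¬ ∀ u, G.Adj w u → u ∉ U) with hY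
  have hXY : X.card + Y.card = d := by
    rw [hX, hY, Finset.card_filter_add_card_filter_not, G.card_neighborFinset_eq_degree, hreg v]
  have hYc : Y.card ≤ U.card := by
    refine le_trans ?_ (sum_le_U G hC U v (hAU v hv) Y (by
      intro w hw; simpa using (Finset.mem_filter.1 hw).1))
    rw [Finset.card_eq_sum_ones]
    apply Finset.sum_le_sum
    intro w hw
    have := (Finset.mem_filter.1 hw).2
    push Not at this
    obtain ⟨u, hu1, hu2⟩ := this
    exact Finset.card_pos.2 ⟨u, by simp [hu1, hu2]⟩
  obtain ⟨W, hWX, hWc⟩ := Finset.exists_subset_card_eq (show d / 3 ≤ X.card by omega)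
  have hWadj : ∀ w ∈ W, G.Adj v w := fun w hw => by
    simpa using (Finset.mem_filter.1 (hWX hw)).1
  have hcl : ∀ x ∈ A, (∀ u, G.Adj x u → u ∉ U) → ∀ y ∈ cN G x, y ∈ A := by
    intro x hx hxU y hy
    rcases (mem_cN _ _ _).1 hy with rfl | h
    · exact hx
    · exact hA x hx y h (hxU y h)
  refine star_coloring G d hreg hC v W hWadj (by omega) T (by omega) A (hcl v hv hvU) ?_
  intro w hw
  refine hcl w ?_ (Finset.mem_filter.1 (hWX hw)).2
  exact hA v hv w (hWadj w hw) (hvU w (hWadj w hw))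

lemma bcoloring_le {V : Type*} [Fintype V] (G : SimpleGraph V) [DecidableRel G.Adj] (d : ℕ)
    (hreg : G.IsRegularOfDegree d) (k : ℕ) (C : V → Fin k) (h : IsBColoring G k C) : k ≤ d + 1 := by
  classical
  rcases Nat.eq_zero_or_pos k with rfl | hk
  · omega
  obtain ⟨v, hv, hd⟩ := h.2 ⟨0, hk⟩
  have : (Finset.univ : Finset (Fin k)) ⊆ (cN G v).image C := by
    intro q _
    rw [Finset.mem_image]
    by_cases hq : q = ⟨0, hk⟩
    · exact ⟨v, (mem_cN _ _ _).2 (Or.inl rfl), by rw [hv, hq]⟩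
    · obtain ⟨u, hu, hu2⟩ := hd q hq
      exact ⟨u, (mem_cN _ _ _).2 (Or.inr hu), hu2⟩
  have h1 := Finset.card_le_card this
  have h2 := Finset.card_image_le (s := cN G v) (f := C)
  rw [card_cN G d hreg v] at h2
  simp at h1
  omega

/-- If `G` is `d`-regular with no 4-cycle, `κ(G) < (2d-1)/3`, and some minimum vertex cut `U`
leaves at least three connected components, then `φ(G) = d + 1`. -/
theorem bChromatic_eq_of_three_components
    {V : Type*} [Fintype V] (G : SimpleGraph V) [DecidableRel G.Adj] (d : ℕ)
    (hreg : G.IsRegularOfDegree d) (h4 : NoFourCycle G)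
    (hconn : (vertexConnectivity G : ℝ) < (2 * (d : ℝ) - 1) / 3)
    (U : Set V) (hUcard : U.ncard = vertexConnectivity G)
    (hcomp : 3 ≤ Nat.card ((G.induce Uᶜ).ConnectedComponent)) :
    bChromaticNumber G = d + 1 := by
  classical
  have hC := cnf_of_noFourCycle G h4
  have hk : 3 * U.toFinset.card + 2 ≤ 2 * d := by
    rw [← Set.ncard_eq_toFinset_card', hUcard]
    rw [lt_div_iff₀ (by norm_num)] at hconn
    have : vertexConnectivity G * 3 + 1 < 2 * d := by
      have : (vertexConnectivity G : ℝ) * 3 + 1 < 2 * d := by linarith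
      exact_mod_cast this
    omega
  -- three components
  rw [Nat.card_eq_fintype_card] at hcomp
  obtain ⟨κ⟩ : Nonempty (Fin 3 ↪ (G.induce Uᶜ).ConnectedComponent) :=
    Function.Embedding.nonempty_of_card_le (by simpa using hcomp)
  set A : Fin 3 → Set V := fun i => {x | ∃ h : x ∈ Uᶜ, (G.induce Uᶜ).connectedComponentMk ⟨x, h⟩ = κ i}
    with hAdef
  have hAU : ∀ i, ∀ x ∈ A i, x ∉ U.toFinset := by
    rintro i x ⟨h, _⟩
    simpa using h
  have hA : ∀ i, ∀ x ∈ A i, ∀ y, G.Adj x y → y ∉ U.toFinset → y ∈ A i := by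
    rintro i x ⟨h, hx⟩ y hxy hy
    have hy' : y ∈ Uᶜ := by simpa using hy
    refine ⟨hy', ?_⟩
    rw [← hx]
    apply ConnectedComponent.sound
    apply Adj.reachable
    simpa using hxy.symm
  have hAne : ∀ i, (A i).Nonempty := by
    intro i
    obtain ⟨x, hx⟩ := (κ i).exists_rep
    exact ⟨x.1, x.2, hx⟩
  have hAdisj : ∀ i j x, x ∈ A i → x ∈ A j → i = j := by
    rintro i j x ⟨h, hx⟩ ⟨h', hx'⟩
    exact κ.injective (hx.symm.trans hx')
  have hpart : ∀ i : Fin 3, ∃ (c : V → Fin (d+1)) (D : Finset V), (∀ x ∈ D, x ∈ A i) ∧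
      (∀ x ∈ D, ∀ y ∈ D, G.Adj x y → c x ≠ c y) ∧
      ∀ q : Fin (d+1), (q : ℕ) / (d / 3 + 1) = i → ∃ z, c z = q ∧ cN G z ⊆ D ∧ Set.InjOn c (cN G z) := by
    intro i
    obtain ⟨c, D, h1, h2, h3⟩ := part_coloring G d hreg hC U.toFinset hk (A i) (hAU i) (hA i) (hAne i)
      (Finset.univ.filter (fun q : Fin (d+1) => (q : ℕ) / (d / 3 + 1) = i)) (by
        rw [← Finset.card_map Fin.valEmbedding]
        refine le_trans (Finset.card_le_card (t := Finset.Ico ((d/3+1) * i) ((d/3+1) * i + (d/3+1))) ?_) (by simp)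
        intro n hn
        simp only [Finset.mem_map, Finset.mem_filter, Finset.mem_univ, true_and] at hn
        obtain ⟨q, hq, rfl⟩ := hn
        rw [Finset.mem_Ico, ← hq]
        exact ⟨Nat.mul_div_le _ _, Nat.lt_mul_div_succ _ (by omega)⟩)
    exact ⟨c, D, h1, h2, fun q hq => h3 q (by simp [hq])⟩
  choose c D hDA hDc hdom using hpart
  -- gluing
  set c0 : V → Fin (d+1) := fun x => if x ∈ D 0 then c 0 x else if x ∈ D 1 then c 1 x else c 2 x with hc0
  have hglue : ∀ i, ∀ x ∈ D i, c0 x = c i x := by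
    intro i x hx
    have hn : ∀ j, j ≠ i → x ∉ D j := fun j hj h => hj (hAdisj j i x (hDA j x h) (hDA i x hx))
    fin_cases i
    · simp only [hc0]
      rw [if_pos (show x ∈ D 0 from hx)]; rfl
    · simp only [hc0]
      rw [if_neg (hn 0 (by decide)), if_pos (show x ∈ D 1 from hx)]; rfl
    · simp only [hc0]
      rw [if_neg (hn 0 (by decide)), if_neg (hn 1 (by decide))]; rfl
  obtain ⟨C, hC1, hC2⟩ := extend_coloring G d hreg (Finset.univ.biUnion D) c0 (by
    intro x hx y hy hxy
    simp only [Finset.mem_biUnion, Finset.mem_univ, true_and] at hx hy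
    obtain ⟨i, hx⟩ := hx
    obtain ⟨j, hy⟩ := hy
    have : y ∈ A i := hA i x (hDA i x hx) y hxy (hAU j y (hDA j y hy))
    have hij : i = j := hAdisj i j y this (hDA j y hy)
    subst hij
    rw [hglue i x hx, hglue i y hy]
    exact hDc i x hx y hy hxy)
  have hCc : ∀ i, ∀ x ∈ D i, C x = c i x := by
    intro i x hx
    rw [hC1 x (Finset.mem_biUnion.2 ⟨i, Finset.mem_univ _, hx⟩), hglue i x hx]
  apply IsGreatest.csSup_eq
  refine ⟨⟨C, hC2, ?_⟩, ?_⟩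
  · intro q
    have hlt : (q : ℕ) / (d / 3 + 1) < 3 := by
      rw [Nat.div_lt_iff_lt_mul (by omega)]
      have := q.2
      omega
    obtain ⟨z, hz, hzD, hinj⟩ := hdom ⟨_, hlt⟩ q rfl
    set i : Fin 3 := ⟨_, hlt⟩
    have hzz : z ∈ cN G z := (mem_cN _ _ _).2 (Or.inl rfl)
    refine ⟨z, by rw [hCc i z (hzD hzz), hz], ?_⟩
    intro q' hq'
    have himg : (cN G z).image (c i) = Finset.univ := by
      apply Finset.eq_univ_of_card
      rw [Finset.card_image_of_injOn hinj, card_cN G d hreg z, Fintype.card_fin]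
    have : q' ∈ (cN G z).image (c i) := by rw [himg]; simp
    obtain ⟨u, hu, hu2⟩ := Finset.mem_image.1 this
    rcases (mem_cN _ _ _).1 hu with rfl | hadj
    · exact absurd (hu2.symm.trans hz) hq'
    · exact ⟨u, hadj, by rw [hCc i u (hzD hu), hu2]⟩
  · rintro k ⟨C', hC'⟩
    exact bcoloring_le G d hreg k C' hC'
end
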